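/- arXiv:1906.10051 — 4 statements merged into one kernel-verified Lean document; each statement's English description precedes it below -/
import Mathlib

section
/- Let E and F be finite-dimensional real inner product spaces, let 0 < c ≤ C and c' ≤ C' be real numbers, and let u : E × F → ℝ satisfy c I_E ⊕ c' I_F ≤ Hu ≤ C I_E ⊕ C' I_F. For t > 0, define the partial inf-convolution Q_t u(x, y) = inf_{z ∈ E} [u(z, y) + (1/2t)‖z − x‖²]. Then for each (x, y) the infimum is attained at a unique point, Q_t u : E × F → ℝ is differentiable, and its gradient satisfies ∇(Q_t u)(x, y) = ∇u(x − t ∇_x(Q_t u)(x, y), y), where ∇_x(Q_t u) denotes the E-component of ∇(Q_t u). -/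
open Set

/-- A convex function on a finite-dimensional space has a subgradient at every point. -/
lemma ConvexOn.exists_subgradient {V : Type*} [NormedAddCommGroup V] [NormedSpace ℝ V]
    [FiniteDimensional ℝ V] {f : V → ℝ} (hf : ConvexOn ℝ univ f) (p : V) :
    ∃ l : V →L[ℝ] ℝ, ∀ q, f p + l (q - p) ≤ f q := by
  have hcont : Continuous f := continuousOn_univ.mp (hf.continuousOn isOpen_univ)
  have hopen : IsOpen {q : V × ℝ | q.1 ∈ univ ∧ f q.1 < q.2} := by
    simpa using isOpen_lt (hcont.comp continuous_fst) continuous_snd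
  obtain ⟨L, hL⟩ := geometric_hahn_banach_point_open (x := (p, f p))
    hf.convex_strict_epigraph hopen (by simp)
  have hsplit (v : V) (r : ℝ) : L (v, r) = L (v, 0) + r * L (0, 1) := by
    rw [← smul_eq_mul, ← map_smul, ← map_add]
    simp
  have hpos : 0 < L (0, 1) := by
    have h := hL (p, f p + 1) (by simp)
    rw [hsplit p (f p), hsplit p (f p + 1)] at h
    linarith
  refine ⟨-(L (0, 1))⁻¹ • L.comp (ContinuousLinearMap.inl ℝ V ℝ), fun q => ?_⟩
  refine le_of_forall_gt_imp_ge_of_dense fun r hr => ?_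
  have h := hL (q, r) (by simpa using hr)
  rw [hsplit p (f p), hsplit q r] at h
  have hsub : L (q - p, 0) = L (q, 0) - L (p, 0) := by
    rw [← map_sub]
    simp
  simp only [smul_apply, ContinuousLinearMap.comp_apply,
    ContinuousLinearMap.inl_apply, hsub, smul_eq_mul]
  have h2 : f p - r < (L (0, 1))⁻¹ * (L (q, 0) - L (p, 0)) := by
    rw [inv_mul_eq_div, lt_div_iff₀ hpos]
    linarith
  linarith

/-- A function with a quadratic upper tangent at `p` that is midpoint semiconvex at `p` is
differentiable at `p`. -/
lemma hasFDerivAt_of_quadratic_bounds {V : Type*} [NormedAddCommGroup V] [NormedSpace ℝ V]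
    {g : V → ℝ} {p : V} {L : V →L[ℝ] ℝ} {K M : ℝ}
    (hup : ∀ h, g (p + h) ≤ g p + L h + K * ‖h‖ ^ 2)
    (hmid : ∀ h, 2 * g p ≤ g (p + h) + g (p - h) + M * ‖h‖ ^ 2) :
    HasFDerivAt g L p := by
  rw [hasFDerivAt_iff_isLittleO_nhds_zero]
  refine (Asymptotics.IsBigO.of_bound (|K| + |M|) (Filter.Eventually.of_forall fun h => ?_) :
    _ =O[nhds 0] fun h : V => ‖h‖ ^ 2).trans_isLittleO ?_
  · have h1 := hup h
    have h2 := hup (-h)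
    have h3 := hmid h
    rw [← sub_eq_add_neg, map_neg, norm_neg] at h2
    have hK := mul_le_mul_of_nonneg_right (le_abs_self K) (sq_nonneg ‖h‖)
    have hM := mul_le_mul_of_nonneg_right (le_abs_self M) (sq_nonneg ‖h‖)
    have hM' := mul_nonneg (abs_nonneg M) (sq_nonneg ‖h‖)
    rw [Real.norm_of_nonneg (sq_nonneg ‖h‖), Real.norm_eq_abs, abs_le]
    constructor <;> linarith
  · exact Asymptotics.isLittleO_norm_pow_id one_lt_two

lemma abs_prod_quadratic_le {E F : Type*} [SeminormedAddCommGroup E]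
    [SeminormedAddCommGroup F] (a b : ℝ) (h : E × F) :
    |a * ‖h.1‖ ^ 2 + b * ‖h.2‖ ^ 2| ≤ (|a| + |b|) * ‖h‖ ^ 2 := by
  have h1 : ‖h.1‖ ^ 2 ≤ ‖h‖ ^ 2 := by gcongr; exact norm_fst_le h
  have h2 : ‖h.2‖ ^ 2 ≤ ‖h‖ ^ 2 := by gcongr; exact norm_snd_le h
  refine (abs_add_le _ _).trans ?_
  rw [abs_mul, abs_mul, abs_of_nonneg (sq_nonneg ‖h.1‖), abs_of_nonneg (sq_nonneg ‖h.2‖), add_mul]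
  gcongr

section PartialInfConvolution

variable {E F : Type*} [NormedAddCommGroup E] [InnerProductSpace ℝ E]
  [NormedAddCommGroup F] [InnerProductSpace ℝ F]

lemma two_mul_le_of_convexOn_sub_quadratic {c c' : ℝ} {u : E × F → ℝ}
    (hconv : ConvexOn ℝ univ
      (fun p : E × F => u p - c / 2 * ‖p.1‖ ^ 2 - c' / 2 * ‖p.2‖ ^ 2)) (p h : E × F) :
    2 * u p + c * ‖h.1‖ ^ 2 + c' * ‖h.2‖ ^ 2 ≤ u (p + h) + u (p - h) := by
  have key := hconv.2 (mem_univ (p + h)) (mem_univ (p - h))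
    (show (0 : ℝ) ≤ 1 / 2 by norm_num) (show (0 : ℝ) ≤ 1 / 2 by norm_num) (by norm_num)
  have hp : (1 / 2 : ℝ) • (p + h) + (1 / 2 : ℝ) • (p - h) = p := by module
  rw [hp] at key
  simp only [Prod.fst_add, Prod.snd_add, Prod.fst_sub, Prod.snd_sub, smul_eq_mul,
    norm_add_sq_real, norm_sub_sq_real] at key
  linarith

lemma exists_quadratic_upper_bound_of_concaveOn [FiniteDimensional ℝ E] [FiniteDimensional ℝ F]
    {C C' : ℝ} {u : E × F → ℝ}
    (hconc : ConcaveOn ℝ univ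
      (fun p : E × F => u p - C / 2 * ‖p.1‖ ^ 2 - C' / 2 * ‖p.2‖ ^ 2)) (p : E × F) :
    ∃ L : E × F →L[ℝ] ℝ, ∃ K : ℝ, ∀ h, u (p + h) ≤ u p + L h + K * ‖h‖ ^ 2 := by
  obtain ⟨l, hl⟩ := hconc.neg.exists_subgradient p
  refine ⟨-l + C • (innerSL ℝ p.1).comp (ContinuousLinearMap.fst ℝ E F) +
    C' • (innerSL ℝ p.2).comp (ContinuousLinearMap.snd ℝ E F), |C / 2| + |C' / 2|, fun h => ?_⟩
  have h1 := hl (p + h)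
  have h2 := (le_abs_self _).trans (abs_prod_quadratic_le (C / 2) (C' / 2) h)
  simp only [Pi.neg_apply, Prod.fst_add, Prod.snd_add, norm_add_sq_real,
    add_sub_cancel_left] at h1
  simp only [add_apply, neg_apply,
    smul_apply, ContinuousLinearMap.comp_apply,
    ContinuousLinearMap.coe_fst', ContinuousLinearMap.coe_snd', innerSL_apply_apply, smul_eq_mul]
  linarith

lemma exists_forall_inf_convolution_le [FiniteDimensional ℝ E] [FiniteDimensional ℝ F]
    {c c' t : ℝ} (hc : 0 < c) (ht : 0 < t) {u : E × F → ℝ} (hu : Continuous u)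
    (hconv : ConvexOn ℝ univ
      (fun p : E × F => u p - c / 2 * ‖p.1‖ ^ 2 - c' / 2 * ‖p.2‖ ^ 2)) (x : E) (y : F) :
    ∃ z : E, ∀ z' : E,
      u (z, y) + ‖z - x‖ ^ 2 / (2 * t) ≤ u (z', y) + ‖z' - x‖ ^ 2 / (2 * t) := by
  obtain ⟨l, hl⟩ := hconv.exists_subgradient (0, y)
  have hcont : Continuous fun z : E => u (z, y) + ‖z - x‖ ^ 2 / (2 * t) := by fun_prop
  refine hcont.exists_forall_le ?_
  have htend : Filter.Tendsto (fun r : ℝ => r * (c / 2 * r - ‖l‖) + u (0, y))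
      Filter.atTop Filter.atTop := by
    refine Filter.tendsto_atTop_add_const_right _ _ (Filter.tendsto_id.atTop_mul_atTop₀ ?_)
    exact Filter.tendsto_atTop_add_const_right _ _
      (Filter.tendsto_id.const_mul_atTop (half_pos hc))
  refine Filter.tendsto_atTop_mono (fun z => ?_) (htend.comp (tendsto_norm_cocompact_atTop (E := E)))
  have h1 := hl (z, y)
  simp only [Prod.mk_sub_mk, sub_zero, sub_self, norm_zero] at h1
  have h2 : |l (z, 0)| ≤ ‖l‖ * ‖z‖ := by
    refine (l.le_opNorm _).trans_eq ?_
    simp [Prod.norm_mk]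
  have h3 : 0 ≤ ‖z - x‖ ^ 2 / (2 * t) := by positivity
  have h4 := (abs_le.mp h2).1
  simp only [Function.comp_apply]
  nlinarith

lemma inf_convolution_minimizer_unique {c c' t : ℝ} (hc : 0 < c) (ht : 0 < t) {u : E × F → ℝ}
    (hconv : ConvexOn ℝ univ
      (fun p : E × F => u p - c / 2 * ‖p.1‖ ^ 2 - c' / 2 * ‖p.2‖ ^ 2)) {x z w : E} {y : F}
    (hz : ∀ z' : E, u (z, y) + ‖z - x‖ ^ 2 / (2 * t) ≤ u (z', y) + ‖z' - x‖ ^ 2 / (2 * t))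
    (hw : ∀ z' : E, u (w, y) + ‖w - x‖ ^ 2 / (2 * t) ≤ u (z', y) + ‖z' - x‖ ^ 2 / (2 * t)) :
    w = z := by
  obtain ⟨m, d, rfl, rfl⟩ : ∃ m d : E, z = m + d ∧ w = m - d :=
    ⟨(1 / 2 : ℝ) • (z + w), (1 / 2 : ℝ) • (z - w), by module, by module⟩
  have h1 := two_mul_le_of_convexOn_sub_quadratic hconv (m, y) (d, 0)
  have h2 := hz m
  have h3 := hw m
  simp only [Prod.mk_add_mk, Prod.mk_sub_mk, add_zero, sub_zero, norm_zero] at h1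
  have e1 : m + d - x = (m - x) + d := by abel
  have e2 : m - d - x = (m - x) - d := by abel
  rw [e1, norm_add_sq_real] at h2
  rw [e2, norm_sub_sq_real] at h3
  simp only [add_div, sub_div] at h2 h3
  have h4 : 0 ≤ ‖d‖ ^ 2 / (2 * t) := by positivity
  have h5 : c * ‖d‖ ^ 2 ≤ 0 := by linarith
  have h6 : ‖d‖ ^ 2 = 0 := le_antisymm (by nlinarith) (sq_nonneg _)
  have h7 : d = 0 := by simpa using h6
  simp [h7]

end PartialInfConvolution

/-- for `u` on `E × F` with `c I_E ⊕ c' I_F ≤ Hu ≤ C I_E ⊕ C' I_F` and `t > 0`,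
the partial inf-convolution `Q_t u(x,y) = inf_z [u(z,y) + ‖z-x‖²/(2t)]` has its infimum
attained at a unique point, is differentiable, and its derivative satisfies
`D(Q_t u)(x,y) = Du(x - t ∇_x(Q_t u)(x,y), y)`. -/
theorem stmt12 {E F : Type*}
    [NormedAddCommGroup E] [InnerProductSpace ℝ E] [FiniteDimensional ℝ E]
    [NormedAddCommGroup F] [InnerProductSpace ℝ F] [FiniteDimensional ℝ F]
    (c C c' C' : ℝ) (hc : 0 < c) (hcC : c ≤ C) (hc'C' : c' ≤ C')
    (u : E × F → ℝ)
    (hconv : ConvexOn ℝ univ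
      (fun p : E × F => u p - c / 2 * ‖p.1‖ ^ 2 - c' / 2 * ‖p.2‖ ^ 2))
    (hconc : ConcaveOn ℝ univ
      (fun p : E × F => u p - C / 2 * ‖p.1‖ ^ 2 - C' / 2 * ‖p.2‖ ^ 2))
    (t : ℝ) (ht : 0 < t)
    (Q : E × F → ℝ)
    (hQ : ∀ (x : E) (y : F),
      Q (x, y) = ⨅ z : E, (u (z, y) + ‖z - x‖ ^ 2 / (2 * t))) :
    (∀ (x : E) (y : F), ∃! z : E, ∀ z' : E,
      u (z, y) + ‖z - x‖ ^ 2 / (2 * t) ≤ u (z', y) + ‖z' - x‖ ^ 2 / (2 * t)) ∧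
    Differentiable ℝ Q ∧
    ∀ (x : E) (y : F),
      fderiv ℝ Q (x, y) =
        fderiv ℝ u (x - t • gradient (fun x' => Q (x', y)) x, y) := by
  have hmid := two_mul_le_of_convexOn_sub_quadratic hconv
  have hderiv (p : E × F) : ∃ L : E × F →L[ℝ] ℝ, ∃ K : ℝ, HasFDerivAt u L p ∧
      ∀ h, u (p + h) ≤ u p + L h + K * ‖h‖ ^ 2 := by
    obtain ⟨L, K, hL⟩ := exists_quadratic_upper_bound_of_concaveOn hconc p
    refine ⟨L, K, hasFDerivAt_of_quadratic_bounds (M := |c| + |c'|) hL fun h => ?_, hL⟩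
    have h1 := (abs_le.mp (abs_prod_quadratic_le c c' h)).1
    linarith [hmid p h]
  have hdiff (p : E × F) : DifferentiableAt ℝ u p := by
    obtain ⟨L, K, hL, -⟩ := hderiv p
    exact hL.differentiableAt
  have hucont : Continuous u := continuous_iff_continuousAt.mpr fun p => (hdiff p).continuousAt
  have hex := exists_forall_inf_convolution_le hc ht hucont hconv
  have hQle (x : E) (y : F) (z : E) : Q (x, y) ≤ u (z, y) + ‖z - x‖ ^ 2 / (2 * t) := by
    obtain ⟨w, hw⟩ := hex x y
    rw [hQ]
    exact ciInf_le ⟨_, forall_mem_range.mpr hw⟩ z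
  have hQeq (x : E) (y : F) : ∃ z, (∀ z' : E,
      u (z, y) + ‖z - x‖ ^ 2 / (2 * t) ≤ u (z', y) + ‖z' - x‖ ^ 2 / (2 * t)) ∧
      Q (x, y) = u (z, y) + ‖z - x‖ ^ 2 / (2 * t) := by
    obtain ⟨w, hw⟩ := hex x y
    refine ⟨w, hw, le_antisymm (hQle x y w) ?_⟩
    rw [hQ]
    exact le_ciInf hw
  have hQderiv (x : E) (y : F) (z : E)
      (hz : Q (x, y) = u (z, y) + ‖z - x‖ ^ 2 / (2 * t)) :
      HasFDerivAt Q (fderiv ℝ u (z, y)) (x, y) := by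
    obtain ⟨L, K, hLu, hL⟩ := hderiv (z, y)
    rw [hLu.fderiv]
    refine hasFDerivAt_of_quadratic_bounds (K := K) (M := |(0 : ℝ)| + |c'|) ?_ ?_
    · rintro ⟨h, k⟩
      have h1 := hQle (x + h) (y + k) (z + h)
      have h2 := hL (h, k)
      rw [add_sub_add_right_eq_sub] at h1
      rw [Prod.mk_add_mk] at h2 ⊢
      linarith
    · rintro ⟨h, k⟩
      obtain ⟨a, -, ha⟩ := hQeq (x + h) (y + k)
      obtain ⟨b, -, hb⟩ := hQeq (x - h) (y - k)
      obtain ⟨m, d, rfl, rfl⟩ : ∃ m d : E, a = m + d ∧ b = m - d :=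
        ⟨(1 / 2 : ℝ) • (a + b), (1 / 2 : ℝ) • (a - b), by module, by module⟩
      have h1 := hQle x y m
      have h2 := hmid (m, y) (d, k)
      have h3 := (abs_le.mp (abs_prod_quadratic_le 0 c' (h, k))).1
      have e1 : m + d - (x + h) = (m - x) + (d - h) := by abel
      have e2 : m - d - (x - h) = (m - x) - (d - h) := by abel
      rw [e1, norm_add_sq_real] at ha
      rw [e2, norm_sub_sq_real] at hb
      simp only [add_div, sub_div] at ha hb
      simp only [Prod.mk_add_mk, Prod.mk_sub_mk] at h2 h3 ⊢
      have h4 : 0 ≤ ‖d - h‖ ^ 2 / (2 * t) := by positivity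
      have h5 : 0 ≤ c * ‖d‖ ^ 2 := by positivity
      linarith
  refine ⟨fun x y => ?_, ?_, fun x y => ?_⟩
  · obtain ⟨z, hz⟩ := hex x y
    exact ⟨z, hz, fun w hw => inf_convolution_minimizer_unique hc ht hconv hz hw⟩
  · rintro ⟨x, y⟩
    obtain ⟨z, -, hz⟩ := hQeq x y
    exact (hQderiv x y z hz).differentiableAt
  · obtain ⟨z, hmin, hz⟩ := hQeq x y
    have hQd := hQderiv x y z hz
    have hpair (w : E) : HasFDerivAt (fun x' : E => (x', y)) (ContinuousLinearMap.inl ℝ E F) w :=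
      hasFDerivAt_prodMk_left w y
    have hsq : HasFDerivAt (fun w : E => ‖w - x‖ ^ 2)
        (2 • (innerSL ℝ (z - x)).comp (ContinuousLinearMap.id ℝ E)) z :=
      ((hasFDerivAt_id z).sub_const x).norm_sq
    have hzero := IsLocalMin.hasFDerivAt_eq_zero (Filter.Eventually.of_forall hmin)
      (((hdiff (z, y)).hasFDerivAt.comp z (hpair z)).add (hsq.mul_const (2 * t)⁻¹))
    have hgrad : HasGradientAt (fun x' => Q (x', y)) (t⁻¹ • (x - z)) x := by
      rw [hasGradientAt_iff_hasFDerivAt]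
      refine (hQd.comp x (hpair x)).congr_fderiv ?_
      ext v
      have hv := DFunLike.congr_fun hzero v
      simp only [add_apply, ContinuousLinearMap.comp_apply,
        smul_apply, innerSL_apply_apply, smul_eq_mul,
        zero_apply, ContinuousLinearMap.id_apply, nsmul_eq_mul] at hv
      rw [InnerProductSpace.toDual_apply_apply, real_inner_smul_left,
        ContinuousLinearMap.comp_apply, ← neg_sub z x, inner_neg_left]
      field_simp at hv ⊢
      push_cast at hv
      linarith
    rw [hgrad.gradient, smul_inv_smul₀ ht.ne', sub_sub_cancel]
    exact hQd.fderiv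
end

section
/- Let E and F be finite-dimensional real inner product spaces, let 0 < c ≤ C and c' ≤ C' be real numbers, and let u : E × F → ℝ satisfy c I_E ⊕ c' I_F ≤ Hu ≤ C I_E ⊕ C' I_F. For t > 0, define Q_t u(x, y) = inf_{z ∈ E} [u(z, y) + (1/2t)‖z − x‖²]. Then c(1 + ct)^{−1} I_E ⊕ c' I_F ≤ H(Q_t u) ≤ C(1 + Ct)^{−1} I_E ⊕ C' I_F, i.e. (x,y) ↦ Q_t u(x,y) − (c/(2(1+ct)))‖x‖² − (c'/2)‖y‖² is convex and (x,y) ↦ Q_t u(x,y) − (C/(2(1+Ct)))‖x‖² − (C'/2)‖y‖² is concave. -/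
open Set

/-- A convex function on a finite-dimensional space decreases at most linearly. -/
lemma ConvexOn.exists_sub_mul_norm_le {E : Type*} [NormedAddCommGroup E] [NormedSpace ℝ E]
    [FiniteDimensional ℝ E] {f : E → ℝ} (hf : ConvexOn ℝ univ f) (w : E) :
    ∃ D, ∀ z, f w - D * (1 + ‖z - w‖) ≤ f z := by
  have hcont : ContinuousOn f (Metric.closedBall w 1) :=
    (hf.continuousOn isOpen_univ).mono (subset_univ _)
  obtain ⟨m, hm⟩ := (isCompact_closedBall w 1).bddBelow_image hcont
  replace hm : ∀ z, ‖z - w‖ ≤ 1 → m ≤ f z := fun z hz =>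
    hm (mem_image_of_mem f (mem_closedBall_iff_norm.2 hz))
  have hmw : m ≤ f w := hm w (by simp)
  refine ⟨f w - m, fun z => ?_⟩
  rcases le_total ‖z - w‖ 1 with h | h
  · nlinarith [hm z h, norm_nonneg (z - w)]
  · set r := ‖z - w‖ with hr
    have hr0 : 0 < r := by linarith
    have hnear : m ≤ f ((1 - r⁻¹) • w + r⁻¹ • z) := by
      refine hm _ (le_of_eq ?_)
      rw [show (1 - r⁻¹) • w + r⁻¹ • z - w = r⁻¹ • (z - w) by module, norm_smul, ← hr,
        Real.norm_of_nonneg (inv_nonneg.2 hr0.le), inv_mul_cancel₀ hr0.ne']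
    have hconv := hf.2 (mem_univ w) (mem_univ z) (sub_nonneg.2 (inv_le_one_of_one_le₀ h))
      (inv_nonneg.2 hr0.le) (sub_add_cancel _ _)
    simp only [smul_eq_mul] at hconv
    have hmul := mul_le_mul_of_nonneg_left (hnear.trans hconv) hr0.le
    have hcancel : r * ((1 - r⁻¹) * f w + r⁻¹ * f z) = (r - 1) * f w + f z := by
      field_simp
    rw [hcancel] at hmul
    linarith

/-- Adding a positive multiple of a squared distance to a convex function makes it bounded below. -/
lemma ConvexOn.bddBelow_range_add_mul_norm_sq {E : Type*} [NormedAddCommGroup E]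
    [NormedSpace ℝ E] [FiniteDimensional ℝ E] {f : E → ℝ} (hf : ConvexOn ℝ univ f) {k : ℝ}
    (hk : 0 < k) (w : E) : BddBelow (range fun z => f z + k * ‖z - w‖ ^ 2) := by
  obtain ⟨D, hD⟩ := hf.exists_sub_mul_norm_le w
  refine ⟨f w - D - D ^ 2 / (4 * k), ?_⟩
  rintro _ ⟨z, rfl⟩
  have hsq : k * (‖z - w‖ - D / (2 * k)) ^ 2
      = k * ‖z - w‖ ^ 2 - D * ‖z - w‖ + D ^ 2 / (4 * k) := by
    field_simp
    ring
  have hnonneg : 0 ≤ k * (‖z - w‖ - D / (2 * k)) ^ 2 := by positivity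
  linarith [hD z]

/-- The partial infimum of a jointly convex function is convex. -/
lemma ConvexOn.iInf_partial {Z P : Type*} [AddCommGroup Z] [Module ℝ Z] [AddCommGroup P]
    [Module ℝ P] {G : Z × P → ℝ} (hG : ConvexOn ℝ univ G)
    (hbdd : ∀ p, BddBelow (range fun z => G (z, p))) :
    ConvexOn ℝ univ fun p => ⨅ z, G (z, p) := by
  refine ⟨convex_univ, fun p _ q _ a b ha hb hab => ?_⟩
  simp only [smul_eq_mul, Real.mul_iInf_of_nonneg ha, Real.mul_iInf_of_nonneg hb]
  exact le_ciInf_add_ciInf fun z w => (ciInf_le (hbdd _) (a • z + b • w)).trans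
    (hG.2 (mem_univ (z, p)) (mem_univ (w, q)) ha hb hab)

/-- A pointwise infimum of concave functions is concave. -/
lemma concaveOn_univ_iInf {ι P : Type*} [Nonempty ι] [AddCommGroup P] [Module ℝ P]
    {G : ι → P → ℝ} (hG : ∀ i, ConcaveOn ℝ univ (G i))
    (hbdd : ∀ p, BddBelow (range fun i => G i p)) :
    ConcaveOn ℝ univ fun p => ⨅ i, G i p := by
  refine ⟨convex_univ, fun p _ q _ a b ha hb hab => le_ciInf fun i => ?_⟩
  refine le_trans ?_ ((hG i).2 (mem_univ p) (mem_univ q) ha hb hab)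
  exact add_le_add (smul_le_smul_of_nonneg_left (ciInf_le (hbdd p) i) ha)
    (smul_le_smul_of_nonneg_left (ciInf_le (hbdd q) i) hb)

/-- Completing the square in the inf-convolution of two quadratic forms. -/
lemma half_mul_norm_sq_add_norm_sub_sq_div {E : Type*} [NormedAddCommGroup E]
    [InnerProductSpace ℝ E] {a t : ℝ} (ht : t ≠ 0) (hat : 1 + a * t ≠ 0) (x z : E) :
    a / 2 * ‖z‖ ^ 2 + ‖z - x‖ ^ 2 / (2 * t)
      = (1 + a * t) / (2 * t) * ‖z - (1 + a * t)⁻¹ • x‖ ^ 2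
        + a / (2 * (1 + a * t)) * ‖x‖ ^ 2 := by
  rw [norm_sub_sq_real, norm_sub_sq_real, inner_smul_right, norm_smul, mul_pow, norm_inv, inv_pow,
    Real.norm_eq_abs, sq_abs]
  field_simp
  ring

/-- the partial inf-convolution `Q_t u` of a function `u` with
`c I_E ⊕ c' I_F ≤ Hu ≤ C I_E ⊕ C' I_F` satisfies
`c(1+ct)⁻¹ I_E ⊕ c' I_F ≤ H(Q_t u) ≤ C(1+Ct)⁻¹ I_E ⊕ C' I_F`. -/
theorem stmt13 {E F : Type*}
    [NormedAddCommGroup E] [InnerProductSpace ℝ E] [FiniteDimensional ℝ E]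
    [NormedAddCommGroup F] [InnerProductSpace ℝ F] [FiniteDimensional ℝ F]
    (c C c' C' : ℝ) (hc : 0 < c) (hcC : c ≤ C) (hc'C' : c' ≤ C')
    (u : E × F → ℝ)
    (hconv : ConvexOn ℝ univ
      (fun p : E × F => u p - c / 2 * ‖p.1‖ ^ 2 - c' / 2 * ‖p.2‖ ^ 2))
    (hconc : ConcaveOn ℝ univ
      (fun p : E × F => u p - C / 2 * ‖p.1‖ ^ 2 - C' / 2 * ‖p.2‖ ^ 2))
    (t : ℝ) (ht : 0 < t)
    (Q : E × F → ℝ)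
    (hQ : ∀ (x : E) (y : F),
      Q (x, y) = ⨅ z : E, (u (z, y) + ‖z - x‖ ^ 2 / (2 * t))) :
    ConvexOn ℝ univ
      (fun p : E × F =>
        Q p - c / (2 * (1 + c * t)) * ‖p.1‖ ^ 2 - c' / 2 * ‖p.2‖ ^ 2) ∧
    ConcaveOn ℝ univ
      (fun p : E × F =>
        Q p - C / (2 * (1 + C * t)) * ‖p.1‖ ^ 2 - C' / 2 * ‖p.2‖ ^ 2) := by
  have hbdd (x : E) (y : F) : BddBelow (range fun z => u (z, y) + ‖z - x‖ ^ 2 / (2 * t)) := by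
    have hslice : ConvexOn ℝ univ fun z => u (z, y) - c / 2 * ‖z‖ ^ 2 - c' / 2 * ‖y‖ ^ 2 := by
      refine ⟨convex_univ, fun z _ w _ a b ha hb hab => ?_⟩
      have h := hconv.2 (mem_univ (z, y)) (mem_univ (w, y)) ha hb hab
      simpa [Prod.smul_mk, Convex.combo_self hab] using h
    have hat : 0 < 1 + c * t := by positivity
    obtain ⟨m, hm⟩ := hslice.bddBelow_range_add_mul_norm_sq
      (k := (1 + c * t) / (2 * t)) (by positivity) ((1 + c * t)⁻¹ • x)
    refine ⟨m + c / (2 * (1 + c * t)) * ‖x‖ ^ 2 + c' / 2 * ‖y‖ ^ 2, ?_⟩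
    rintro _ ⟨z, rfl⟩
    have h := hm (mem_range_self z)
    have hsq := half_mul_norm_sq_add_norm_sub_sq_div ht.ne' hat.ne' x z
    dsimp only at h ⊢
    linarith
  have hshift (a a' : ℝ) (ha : 0 < a) (p : E × F) :
      BddBelow (range fun z => (u (z, p.2) - a / 2 * ‖z‖ ^ 2 - a' / 2 * ‖p.2‖ ^ 2)
        + (1 + a * t) / (2 * t) * ‖z - (1 + a * t)⁻¹ • p.1‖ ^ 2) ∧
      Q p - a / (2 * (1 + a * t)) * ‖p.1‖ ^ 2 - a' / 2 * ‖p.2‖ ^ 2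
        = ⨅ z, ((u (z, p.2) - a / 2 * ‖z‖ ^ 2 - a' / 2 * ‖p.2‖ ^ 2)
          + (1 + a * t) / (2 * t) * ‖z - (1 + a * t)⁻¹ • p.1‖ ^ 2) := by
    have hat : 0 < 1 + a * t := by positivity
    have heq : (fun z => (u (z, p.2) - a / 2 * ‖z‖ ^ 2 - a' / 2 * ‖p.2‖ ^ 2)
          + (1 + a * t) / (2 * t) * ‖z - (1 + a * t)⁻¹ • p.1‖ ^ 2)
        = fun z => (u (z, p.2) + ‖z - p.1‖ ^ 2 / (2 * t))
          - (a / (2 * (1 + a * t)) * ‖p.1‖ ^ 2 + a' / 2 * ‖p.2‖ ^ 2) := by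
      funext z
      linarith [half_mul_norm_sq_add_norm_sub_sq_div ht.ne' hat.ne' p.1 z]
    rw [heq, ← ciInf_sub (hbdd p.1 p.2), ← hQ, sub_sub]
    refine ⟨?_, rfl⟩
    obtain ⟨m, hm⟩ := hbdd p.1 p.2
    refine ⟨m - (a / (2 * (1 + a * t)) * ‖p.1‖ ^ 2 + a' / 2 * ‖p.2‖ ^ 2), ?_⟩
    rintro _ ⟨z, rfl⟩
    exact sub_le_sub_right (hm (mem_range_self z)) _
  constructor
  · simp only [fun p => (hshift c c' hc p).2]
    refine ConvexOn.iInf_partial (G := fun q : E × E × F =>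
      (u (q.1, q.2.2) - c / 2 * ‖q.1‖ ^ 2 - c' / 2 * ‖q.2.2‖ ^ 2)
        + (1 + c * t) / (2 * t) * ‖q.1 - (1 + c * t)⁻¹ • q.2.1‖ ^ 2) ?_
      fun p => (hshift c c' hc p).1
    have hu := hconv.comp_linearMap ((LinearMap.fst ℝ E (E × F)).prod
      (LinearMap.snd ℝ E F ∘ₗ LinearMap.snd ℝ E (E × F)))
    have hsq : ConvexOn ℝ univ fun v : E => ‖v‖ ^ 2 :=
      convexOn_univ_norm.pow (fun _ _ => norm_nonneg _) 2
    have hsq' := hsq.comp_linearMap (LinearMap.fst ℝ E (E × F)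
      - (1 + c * t)⁻¹ • (LinearMap.fst ℝ E F ∘ₗ LinearMap.snd ℝ E (E × F)))
    exact hu.add (hsq'.smul (by positivity : 0 ≤ (1 + c * t) / (2 * t)))
  · have hC : 0 < C := hc.trans_le hcC
    let T (x : E) : E ≃ E := Equiv.addRight ((1 + C * t)⁻¹ • x)
    have hreindex (p : E × F) := (T p.1).iInf_comp (g := fun z =>
      (u (z, p.2) - C / 2 * ‖z‖ ^ 2 - C' / 2 * ‖p.2‖ ^ 2)
        + (1 + C * t) / (2 * t) * ‖z - (1 + C * t)⁻¹ • p.1‖ ^ 2)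
    simp only [fun p => (hshift C C' hC p).2, ← hreindex]
    refine concaveOn_univ_iInf (fun z => ?_)
      fun p => (hshift C C' hC p).1.mono (by rintro _ ⟨z, rfl⟩; exact ⟨T p.1 z, rfl⟩)
    have hu := (hconc.translate_left (z, (0 : F))).comp_linearMap
      (((1 + C * t)⁻¹ • LinearMap.fst ℝ E F).prod (LinearMap.snd ℝ E F))
    refine (hu.add_const ((1 + C * t) / (2 * t) * ‖z‖ ^ 2)).congr fun p _ => ?_
    simp [T, add_comm]
end

section
/- Let E and F be finite-dimensional real inner product spaces and 0 < c ≤ C. For each s ≥ 0 let V_s : E × F → ℝ satisfy c(1 + cs)^{−1} I_E ⊕ c I_F ≤ HV_s ≤ C(1 + Cs)^{−1} I_E ⊕ C I_F, and for s, t ∈ [0, ∞) let F_{s,t} : E × F → E satisfy F_{t,t}(x, y) = x and ∂_s F_{s,t}(x, y) = (1/2) ∇_x V_s(F_{s,t}(x, y), y). Define F̃_{s,t}(x, y) = e^{−s/2} F_{e^s − 1, e^t − 1}(e^{t/2} x, y) and let π₁ : E × F → E denote the projection π₁(x, y) = x. Then for all s, t ∈ [0, ∞): (i) ‖F̃_{s,t}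 − π₁‖_{Lip,dx} ≤ (1/2)(max(C, 1/c) − 1) max(C, 1/c)^{1/2} |e^{−s} − e^{−t}|; (ii) ‖F̃_{s,t} − π₁‖_{Lip} ≤ (max(C, 1/c)³ − 1) max(C, 1/c)^{1/2} |e^{−s/2} − e^{−t/2}|. -/
open Set

section
variable {E F : Type*} [NormedAddCommGroup E] [InnerProductSpace ℝ E]
  [NormedAddCommGroup F] [InnerProductSpace ℝ F]

/-- Optimizing over `w`, a linear functional dominated by a quadratic is bounded. -/
lemma norm_le_of_forall_inner_le {g : E} {α β D : ℝ} (hα : 0 ≤ α) (hD : 0 ≤ D)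
    (h : ∀ w : E, inner ℝ g w ≤ α * ‖w‖ ^ 2 + β * D ^ 2) : ‖g‖ ≤ (α + β) * D := by
  rcases hD.eq_or_lt with rfl | hD
  · have h1 := h ((1 / (2 * (α + 1))) • g)
    rw [inner_smul_right, real_inner_self_eq_norm_sq, norm_smul, Real.norm_eq_abs, mul_pow,
      sq_abs] at h1
    have h2 : α * (1 / (2 * (α + 1))) ≤ 1 / 2 := by
      rw [mul_one_div, div_le_div_iff₀ (by positivity) (by norm_num)]; linarith
    have h3 : 0 < 1 / (2 * (α + 1)) := by positivity
    have h4 : ‖g‖ ^ 2 ≤ 0 := by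
      by_contra! hpos
      nlinarith [mul_pos h3 hpos, mul_le_mul_of_nonneg_right h2 (mul_pos h3 hpos).le]
    have : ‖g‖ = 0 := by nlinarith [norm_nonneg g]
    simp [this]
  · rcases eq_or_ne g 0 with rfl | hg
    · have := h 0
      simp only [inner_zero_left, norm_zero] at this ⊢
      have h5 : 0 ≤ β := by
        by_contra! hb
        nlinarith [mul_neg_of_neg_of_pos hb (pow_pos hD 2)]
      positivity
    · have hg' : 0 < ‖g‖ := norm_pos_iff.2 hg
      have h1 := h ((D / ‖g‖) • g)
      rw [inner_smul_right, real_inner_self_eq_norm_sq, norm_smul, Real.norm_eq_abs,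
        abs_of_pos (by positivity), div_mul_cancel₀ _ hg'.ne'] at h1
      have h2 : D / ‖g‖ * ‖g‖ ^ 2 = ‖g‖ * D := by field_simp
      rw [h2] at h1
      refine le_of_mul_le_mul_right ?_ hD
      linarith

lemma norm_midpoint_sq (x y : E) :
    ‖(1 / 2 : ℝ) • x + (1 / 2 : ℝ) • y‖ ^ 2
      = 1 / 2 * ‖x‖ ^ 2 + 1 / 2 * ‖y‖ ^ 2 - 1 / 4 * ‖x - y‖ ^ 2 := by
  rw [norm_add_sq_real, norm_sub_sq_real, inner_smul_left, inner_smul_right, norm_smul, norm_smul]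
  norm_num
  ring

lemma convexOn_quadratic {α β : ℝ} (hα : 0 ≤ α) (hβ : 0 ≤ β) :
    ConvexOn ℝ univ fun p : E × F => α * ‖p.1‖ ^ 2 + β * ‖p.2‖ ^ 2 := by
  have h1 : ConvexOn ℝ univ fun x : E => ‖x‖ ^ 2 :=
    convexOn_univ_norm.pow (fun x _ => norm_nonneg x) 2
  have h2 : ConvexOn ℝ univ fun x : F => ‖x‖ ^ 2 :=
    convexOn_univ_norm.pow (fun x _ => norm_nonneg x) 2
  exact (((h1.comp_linearMap (LinearMap.fst ℝ E F)).smul hα).add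
    ((h2.comp_linearMap (LinearMap.snd ℝ E F)).smul hβ)).congr fun p _ => by simp

lemma ConvexOn.slice {U : E × F → ℝ} {a a' : ℝ}
    (h : ConvexOn ℝ univ fun p : E × F => U p - a / 2 * ‖p.1‖ ^ 2 - a' / 2 * ‖p.2‖ ^ 2) (y : F) :
    ConvexOn ℝ univ fun x => U (x, y) - a / 2 * ‖x‖ ^ 2 := by
  exact ((h.comp_affineMap ((AffineMap.id ℝ E).prod (AffineMap.const ℝ E y))).add_const
    (a' / 2 * ‖y‖ ^ 2)).congr fun x _ => by simp

lemma ConcaveOn.slice {U : E × F → ℝ} {a a' : ℝ}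
    (h : ConcaveOn ℝ univ fun p : E × F => U p - a / 2 * ‖p.1‖ ^ 2 - a' / 2 * ‖p.2‖ ^ 2) (y : F) :
    ConcaveOn ℝ univ fun x => U (x, y) - a / 2 * ‖x‖ ^ 2 := by
  exact ((h.comp_affineMap ((AffineMap.id ℝ E).prod (AffineMap.const ℝ E y))).add_const
    (a' / 2 * ‖y‖ ^ 2)).congr fun x _ => by simp

/-! ### Differential inequalities on the half-line -/

/-- If `σ n' ≤ 2 ψ' √n` with `n ≥ 0` and `ψ' ≥ 0`, then `σ √n - ψ` is nonincreasing. -/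
lemma antitoneOn_mul_sqrt_sub {n n' ψ ψ' : ℝ → ℝ} {σ : ℝ}
    (hn : ∀ s ∈ Ici (0 : ℝ), HasDerivWithinAt n (n' s) (Ici 0) s)
    (hψ : ∀ s ∈ Ici (0 : ℝ), HasDerivWithinAt ψ (ψ' s) (Ici 0) s)
    (hn0 : ∀ s ∈ Ici (0 : ℝ), 0 ≤ n s) (hψ0 : ∀ s ∈ Ici (0 : ℝ), 0 ≤ ψ' s)
    (h : ∀ s ∈ Ici (0 : ℝ), σ * n' s ≤ 2 * ψ' s * √(n s)) :
    AntitoneOn (fun s => σ * √(n s) - ψ s) (Ici 0) := by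
  have hε : ∀ ε > 0, AntitoneOn (fun s => σ * √(n s + ε) - ψ s) (Ici 0) := fun ε hε => by
    have hd : ∀ s ∈ Ici (0 : ℝ), HasDerivWithinAt (fun s => σ * √(n s + ε) - ψ s)
        (σ * (n' s / (2 * √(n s + ε))) - ψ' s) (Ici 0) s := fun s hs =>
      ((((hn s hs).add_const ε).sqrt (by linarith [hn0 s hs])).const_mul σ).sub (hψ s hs)
    refine antitoneOn_of_hasDerivWithinAt_nonpos (convex_Ici 0)
      (fun s hs => (hd s hs).continuousWithinAt)
      (fun s hs => (hd s (interior_subset hs)).mono interior_subset) fun s hs => ?_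
    have hs := interior_subset hs
    have hpos : 0 < √(n s + ε) := Real.sqrt_pos.2 (by linarith [hn0 s hs])
    have hle : √(n s) ≤ √(n s + ε) := Real.sqrt_le_sqrt (by linarith)
    rw [sub_nonpos, ← mul_div_assoc, div_le_iff₀ (by positivity)]
    nlinarith [h s hs, mul_le_mul_of_nonneg_left hle (hψ0 s hs)]
  intro s hs t ht hst
  have hlim : ∀ r, Filter.Tendsto (fun ε => σ * √(n r + ε) - ψ r) (nhdsWithin 0 (Ioi 0))
      (nhds (σ * √(n r) - ψ r)) := fun r => by
    refine Filter.Tendsto.mono_left ?_ nhdsWithin_le_nhds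
    have : Continuous fun ε => σ * √(n r + ε) - ψ r := by fun_prop
    simpa using this.tendsto 0
  exact le_of_tendsto_of_tendsto (hlim t) (hlim s)
    (Filter.eventually_of_mem self_mem_nhdsWithin fun ε he => hε ε he hs ht hst)

/-- A Grönwall estimate for the critical linear rate `k / (2 (1 + k s))`, forward in time for
`σ = 1` and backward for `σ = -1`. -/
lemma antitoneOn_mul_norm_div_sqrt_sub {δ δ' : ℝ → E} {ψ ψ' β : ℝ → ℝ} {σ k : ℝ} (hk : 0 ≤ k)
    (hδ : ∀ s ∈ Ici (0 : ℝ), HasDerivWithinAt δ (δ' s) (Ici 0) s)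
    (hψ : ∀ s ∈ Ici (0 : ℝ), HasDerivWithinAt ψ (ψ' s) (Ici 0) s)
    (hβ0 : ∀ s ∈ Ici (0 : ℝ), 0 ≤ β s)
    (h : ∀ s ∈ Ici (0 : ℝ),
      σ * (2 * inner ℝ (δ' s) (δ s) - k / (1 + k * s) * ‖δ s‖ ^ 2) ≤ β s * ‖δ s‖)
    (hβ : ∀ s ∈ Ici (0 : ℝ), β s ≤ 2 * ψ' s * √(1 + k * s)) :
    AntitoneOn (fun s => σ * (‖δ s‖ / √(1 + k * s)) - ψ s) (Ici 0) := by
  have hpos : ∀ s ∈ Ici (0 : ℝ), 0 < 1 + k * s := fun s hs => by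
    have := mul_nonneg hk (mem_Ici.1 hs); linarith
  have hsq : ∀ s, √(‖δ s‖ ^ 2 / (1 + k * s)) = ‖δ s‖ / √(1 + k * s) := fun s => by
    rw [Real.sqrt_div (sq_nonneg _), Real.sqrt_sq (norm_nonneg _)]
  simp_rw [← hsq]
  refine antitoneOn_mul_sqrt_sub
    (n' := fun s => (2 * inner ℝ (δ s) (δ' s) * (1 + k * s) - ‖δ s‖ ^ 2 * k) / (1 + k * s) ^ 2)
    (fun s hs => ?_) hψ (fun s hs => div_nonneg (sq_nonneg _) (hpos s hs).le)
    (fun s hs => ?_) (fun s hs => ?_)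
  · have h1 : HasDerivWithinAt (fun s => 1 + k * s) k (Ici 0) s := by
      simpa using ((hasDerivWithinAt_id s (Ici 0)).const_mul k).const_add 1
    exact (hδ s hs).norm_sq.div h1 (hpos s hs).ne'
  · have := (hβ0 s hs).trans (hβ s hs)
    have h2 := Real.sqrt_pos.2 (hpos s hs)
    by_contra! hneg
    nlinarith [mul_neg_of_neg_of_pos hneg h2]
  · have h1 := h s hs
    have h2 := hβ s hs
    have h3 := hpos s hs
    have h4 := Real.sqrt_pos.2 h3
    have h5 := Real.sq_sqrt h3.le
    rw [hsq, real_inner_comm]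
    have e1 : σ * ((2 * inner ℝ (δ' s) (δ s) * (1 + k * s) - ‖δ s‖ ^ 2 * k) / (1 + k * s) ^ 2)
        = σ * (2 * inner ℝ (δ' s) (δ s) - k / (1 + k * s) * ‖δ s‖ ^ 2) / (1 + k * s) := by
      field_simp
    have e2 : 2 * ψ' s * (‖δ s‖ / √(1 + k * s))
        = 2 * ψ' s * √(1 + k * s) * ‖δ s‖ / (1 + k * s) := by
      rw [← mul_div_assoc, div_eq_div_iff h4.ne' h3.ne']
      linear_combination 2 * ψ' s * ‖δ s‖ * (-h5)
    rw [e1, e2]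
    exact div_le_div_of_nonneg_right (h1.trans (mul_le_mul_of_nonneg_right h2 (norm_nonneg _))) h3.le

/-- Mean value inequality on the half-line with a variable bound, in both time directions. -/
lemma norm_sub_le_abs_sub_of_deriv {f f' : ℝ → E} {B B' : ℝ → ℝ}
    (hf : ∀ s ∈ Ici (0 : ℝ), HasDerivWithinAt f (f' s) (Ici 0) s)
    (hB : ∀ s ∈ Ici (0 : ℝ), HasDerivWithinAt B (B' s) (Ici 0) s)
    (h : ∀ s ∈ Ici (0 : ℝ), ‖f' s‖ ≤ B' s) {s t : ℝ} (hs : 0 ≤ s) (ht : 0 ≤ t) :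
    ‖f s - f t‖ ≤ |B s - B t| := by
  wlog hts : t ≤ s generalizing s t
  · rw [norm_sub_rev, abs_sub_comm]; exact this ht hs (le_of_not_ge hts)
  have hI : ∀ r ∈ Icc t s, r ∈ Ici (0 : ℝ) := fun r hr => ht.trans hr.1
  refine le_trans ?_ (le_abs_self _)
  refine image_norm_le_of_norm_deriv_right_le_deriv_boundary' (f := fun r => f r - f t)
    (B := fun r => B r - B t) (a := t) (b := s) (f' := f') (B' := B') ?_ ?_ (by simp) ?_ ?_ ?_
    ⟨hts, le_rfl⟩
  · exact fun r hr =>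
      ((hf r (hI r hr)).continuousWithinAt.mono fun _ h => hI _ h).sub continuousWithinAt_const
  · exact fun r hr => ((hf r (ht.trans hr.1)).mono
      fun _ h => (ht.trans hr.1).trans h).sub_const _
  · exact fun r hr =>
      ((hB r (hI r hr)).continuousWithinAt.mono fun _ h => hI _ h).sub continuousWithinAt_const
  · exact fun r hr => ((hB r (ht.trans hr.1)).mono
      fun _ h => (ht.trans hr.1).trans h).sub_const _
  · exact fun r hr => h r (ht.trans hr.1)

lemma hasDerivWithinAt_inv_sqrt_one_add {s : ℝ} (hs : 0 ≤ s) :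
    HasDerivWithinAt (fun s => (√(1 + s))⁻¹) (-(1 / 2 * (√(1 + s))⁻¹ * (1 + s)⁻¹)) (Ici 0) s := by
  have hpos : 0 < 1 + s := by linarith
  have h2 := Real.sq_sqrt hpos.le
  have := ((((hasDerivWithinAt_id s (Ici 0)).const_add 1).sqrt hpos.ne').inv
    (Real.sqrt_pos.2 hpos).ne')
  simp only [id] at this
  refine this.congr_deriv ?_
  rw [h2]
  field_simp

/-- Growth of the distance between two trajectories, in both time directions. -/
lemma norm_le_of_critical_growth {δ δ' : ℝ → E} {L κ : ℝ} (hL : 1 ≤ L) (hκ : 0 ≤ κ)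
    (hδ : ∀ s ∈ Ici (0 : ℝ), HasDerivWithinAt δ (δ' s) (Ici 0) s)
    (hup : ∀ s ∈ Ici (0 : ℝ), 2 * inner ℝ (δ' s) (δ s) ≤
      L / (1 + L * s) * ‖δ s‖ ^ 2 + κ / (1 + s) * ‖δ s‖)
    (hlow : ∀ s ∈ Ici (0 : ℝ), L⁻¹ / (1 + L⁻¹ * s) * ‖δ s‖ ^ 2 - κ / (1 + s) * ‖δ s‖ ≤
      2 * inner ℝ (δ' s) (δ s)) {s t : ℝ} (hs : 0 ≤ s) (ht : 0 ≤ t) :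
    ‖δ s‖ ≤ √L * √(1 + s) * (‖δ t‖ / √(1 + t) + κ * |(√(1 + s))⁻¹ - (√(1 + t))⁻¹|) := by
  have hL0 : 0 < L := by linarith
  have hℓ : L⁻¹ ≤ 1 := inv_le_one_of_one_le₀ hL
  have hℓ0 : 0 < L⁻¹ := inv_pos.2 hL0
  have hLL : L * L⁻¹ = 1 := mul_inv_cancel₀ hL0.ne'
  have hψ : ∀ c : ℝ, ∀ r ∈ Ici (0 : ℝ), HasDerivWithinAt (fun r => -(c * κ) * (√(1 + r))⁻¹)
      (-(c * κ) * -(1 / 2 * (√(1 + r))⁻¹ * (1 + r)⁻¹)) (Ici 0) r := fun c r hr =>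
    (hasDerivWithinAt_inv_sqrt_one_add hr).const_mul _
  have hβ : ∀ c k : ℝ, (∀ r ∈ Ici (0 : ℝ), √(1 + r) ≤ c * √(1 + k * r)) → ∀ r ∈ Ici (0 : ℝ),
      κ / (1 + r) ≤ 2 * (-(c * κ) * -(1 / 2 * (√(1 + r))⁻¹ * (1 + r)⁻¹)) * √(1 + k * r) := by
    intro c k hck r hr
    have hpos : 0 < 1 + r := by have := mem_Ici.1 hr; linarith
    have hsp := Real.sqrt_pos.2 hpos
    calc κ / (1 + r) = κ / (1 + r) * (√(1 + r))⁻¹ * √(1 + r) := by field_simp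
      _ ≤ κ / (1 + r) * (√(1 + r))⁻¹ * (c * √(1 + k * r)) :=
        mul_le_mul_of_nonneg_left (hck r hr) (by positivity)
      _ = _ := by field_simp
  have hκr : ∀ r ∈ Ici (0 : ℝ), 0 ≤ κ / (1 + r) := fun r hr =>
    div_nonneg hκ (by have := mem_Ici.1 hr; linarith)
  have hs1 : 0 < √(1 + s) := Real.sqrt_pos.2 (by linarith)
  have ht1 : 0 < √(1 + t) := Real.sqrt_pos.2 (by linarith)
  set Δ := |(√(1 + s))⁻¹ - (√(1 + t))⁻¹| with hΔ
  rcases le_total t s with hts | hst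
  · have h := antitoneOn_mul_norm_div_sqrt_sub (σ := 1) hL0.le hδ (hψ 1) hκr
      (fun r hr => by linarith [hup r hr])
      (hβ 1 L fun r hr => by
        rw [one_mul]; exact Real.sqrt_le_sqrt (by nlinarith [mem_Ici.1 hr])) ht hs hts
    have hΔ' : Δ = (√(1 + t))⁻¹ - (√(1 + s))⁻¹ := by
      rw [hΔ, abs_sub_comm, abs_of_nonneg]
      exact sub_nonneg.2 (inv_anti₀ ht1 (Real.sqrt_le_sqrt (by linarith)))
    have hpos : 0 < √(1 + L * s) := Real.sqrt_pos.2 (by nlinarith)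
    have h1 : ‖δ s‖ / √(1 + L * s) ≤ ‖δ t‖ / √(1 + L * t) + κ * Δ := by
      rw [hΔ']; linarith
    have h2 : ‖δ t‖ / √(1 + L * t) ≤ ‖δ t‖ / √(1 + t) :=
      div_le_div_of_nonneg_left (norm_nonneg _) ht1 (Real.sqrt_le_sqrt (by nlinarith))
    have h3 : √(1 + L * s) ≤ √L * √(1 + s) := by
      rw [← Real.sqrt_mul hL0.le]; exact Real.sqrt_le_sqrt (by nlinarith)
    rw [div_le_iff₀ hpos] at h1
    calc ‖δ s‖ ≤ (‖δ t‖ / √(1 + L * t) + κ * Δ) * √(1 + L * s) := h1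
      _ ≤ (‖δ t‖ / √(1 + t) + κ * Δ) * (√L * √(1 + s)) := by gcongr
      _ = _ := by ring
  · have hsq : ∀ r ∈ Ici (0 : ℝ), √(1 + r) ≤ √L * √(1 + L⁻¹ * r) := fun r hr => by
      rw [← Real.sqrt_mul hL0.le]
      exact Real.sqrt_le_sqrt (by rw [mul_add, ← mul_assoc, hLL]; linarith)
    have h := antitoneOn_mul_norm_div_sqrt_sub (σ := -1) hℓ0.le hδ (hψ √L) hκr
      (fun r hr => by linarith [hlow r hr]) (hβ √L L⁻¹ hsq) hs ht hst
    have hΔ' : Δ = (√(1 + s))⁻¹ - (√(1 + t))⁻¹ := by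
      rw [hΔ, abs_of_nonneg]
      exact sub_nonneg.2 (inv_anti₀ hs1 (Real.sqrt_le_sqrt (by linarith)))
    have hpos : 0 < √(1 + L⁻¹ * s) := Real.sqrt_pos.2 (by nlinarith)
    have htpos : 0 < √(1 + L⁻¹ * t) := Real.sqrt_pos.2 (by nlinarith)
    have h1 : ‖δ s‖ / √(1 + L⁻¹ * s) ≤ ‖δ t‖ / √(1 + L⁻¹ * t) + √L * κ * Δ := by
      rw [hΔ']; linarith
    have h2 : ‖δ t‖ / √(1 + L⁻¹ * t) ≤ √L * (‖δ t‖ / √(1 + t)) := by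
      rw [← mul_div_assoc, div_le_div_iff₀ htpos ht1]
      nlinarith [mul_le_mul_of_nonneg_left (hsq t ht) (norm_nonneg (δ t))]
    have h3 : √(1 + L⁻¹ * s) ≤ √(1 + s) := Real.sqrt_le_sqrt (by nlinarith)
    rw [div_le_iff₀ hpos] at h1
    calc ‖δ s‖ ≤ (‖δ t‖ / √(1 + L⁻¹ * t) + √L * κ * Δ) * √(1 + L⁻¹ * s) := h1
      _ ≤ (√L * (‖δ t‖ / √(1 + t)) + √L * κ * Δ) * √(1 + s) := by gcongr
      _ = _ := by ring

lemma norm_inv_sqrt_smul_sub_le {δ δ' : ℝ → E} {L D : ℝ} (hL : 1 ≤ L)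
    (hδ : ∀ s ∈ Ici (0 : ℝ), HasDerivWithinAt δ (δ' s) (Ici 0) s)
    (hδ' : ∀ s ∈ Ici (0 : ℝ),
      ‖(2 : ℝ) • δ' s - (1 + s)⁻¹ • δ s‖ ≤ (L - 1) / (1 + s) ^ 2 * ‖δ s‖)
    (hD : ∀ s ∈ Ici (0 : ℝ), ‖δ s‖ ≤ √L * √(1 + s) * D) {s t : ℝ} (hs : 0 ≤ s) (ht : 0 ≤ t) :
    ‖(√(1 + s))⁻¹ • δ s - (√(1 + t))⁻¹ • δ t‖ ≤
      1 / 2 * (L - 1) * √L * |(1 + s)⁻¹ - (1 + t)⁻¹| * D := by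
  have hD0 : 0 ≤ D := by
    have h := (norm_nonneg _).trans (hD 0 self_mem_Ici)
    have : 0 < √L * √(1 + 0) := by
      have := Real.sqrt_pos.2 (zero_lt_one.trans_le hL); simpa
    exact nonneg_of_mul_nonneg_right h this
  set A := 1 / 2 * (L - 1) * √L * D with hA
  have hA0 : 0 ≤ A := by have := sub_nonneg.2 hL; positivity
  have hB : ∀ r ∈ Ici (0 : ℝ), HasDerivWithinAt (fun r => -A * (1 + r)⁻¹)
      (A * ((1 + r) ^ 2)⁻¹) (Ici 0) r := fun r hr => by
    have hpos : 1 + r ≠ 0 := by have := mem_Ici.1 hr; positivity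
    have := ((((hasDerivWithinAt_id r (Ici 0)).const_add 1).inv hpos).const_mul (-A))
    simp only [id] at this
    exact this.congr_deriv (by ring)
  have h := norm_sub_le_abs_sub_of_deriv
    (fun r hr => (hasDerivWithinAt_inv_sqrt_one_add (mem_Ici.1 hr)).smul (hδ r hr)) hB
    (fun r hr => ?_) hs ht
  · refine h.trans_eq ?_
    rw [← mul_sub, abs_mul, abs_neg, abs_of_nonneg hA0]
    ring
  · have hpos : 0 < 1 + r := by have := mem_Ici.1 hr; linarith
    have hsp := Real.sqrt_pos.2 hpos
    have e : (√(1 + r))⁻¹ • δ' r + (-(1 / 2 * (√(1 + r))⁻¹ * (1 + r)⁻¹)) • δ r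
        = (1 / 2 * (√(1 + r))⁻¹) • ((2 : ℝ) • δ' r - (1 + r)⁻¹ • δ r) := by
      module
    rw [e, norm_smul, Real.norm_of_nonneg (by positivity)]
    have h0 := sub_nonneg.2 hL
    calc _ ≤ 1 / 2 * (√(1 + r))⁻¹ * ((L - 1) / (1 + r) ^ 2 * (√L * √(1 + r) * D)) := by
          gcongr
          exact (hδ' r hr).trans (by gcongr; exact hD r hr)
      _ = _ := by rw [hA]; field_simp

/-! ### Consequences of two-sided Hessian bounds -/

variable [FiniteDimensional ℝ E]

lemma ConvexOn.exists_subgradient_s17 {f : E → ℝ} (hf : ConvexOn ℝ univ f) (x : E) :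
    ∃ g : E, ∀ z, f x + inner ℝ g z ≤ f (x + z) := by
  have hcont : Continuous f := continuousOn_univ.1 (hf.continuousOn isOpen_univ)
  have hopen : IsOpen {p : E × ℝ | p.1 ∈ univ ∧ f p.1 < p.2} := by
    simpa using isOpen_lt (hcont.comp continuous_fst) continuous_snd
  obtain ⟨l, hl⟩ := geometric_hahn_banach_point_open (x := (x, f x))
    hf.convex_strict_epigraph hopen (by simp)
  have hsplit : ∀ (z : E) (r : ℝ), l (z, r) = l (z, 0) + r * l (0, 1) := fun z r => by
    rw [← smul_eq_mul, ← map_smul, ← map_add]; simp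
  have hk : 0 < l (0, 1) := by
    have := hl (x, f x + 1) (by simp)
    rw [hsplit x, hsplit x (f x + 1)] at this
    linarith
  have hle : ∀ z, l (x, 0) + f x * l (0, 1) ≤ l (z, 0) + f z * l (0, 1) := fun z => by
    refine le_of_forall_pos_lt_add fun ε hε => ?_
    have := hl (z, f z + ε / l (0, 1)) ⟨mem_univ _, by simpa using div_pos hε hk⟩
    rw [hsplit x, hsplit z, add_mul, div_mul_cancel₀ _ hk.ne'] at this
    linarith
  refine ⟨-(l (0, 1))⁻¹ • (InnerProductSpace.toDual ℝ E).symm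
    (l.comp (ContinuousLinearMap.inl ℝ E ℝ)), fun z => ?_⟩
  have h1 := hle (x + z)
  have h2 : l (x + z, 0) = l (x, 0) + l (z, 0) := by rw [← map_add]; simp
  rw [inner_smul_left, InnerProductSpace.toDual_symm_apply]
  simp only [conj_trivial, ContinuousLinearMap.comp_apply, ContinuousLinearMap.inl_apply]
  rw [h2] at h1
  refine le_of_mul_le_mul_right ?_ hk
  rw [add_mul, neg_mul, neg_mul, mul_right_comm, inv_mul_cancel₀ hk.ne']
  linarith

/-- Two-sided Hessian bounds in the generalized sense give two-sided quadratic Taylor bounds. -/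
lemma gradient_taylor_bounds {φ : E → ℝ} {a b : ℝ}
    (ha : ConvexOn ℝ univ fun x => φ x - a / 2 * ‖x‖ ^ 2)
    (hb : ConcaveOn ℝ univ fun x => φ x - b / 2 * ‖x‖ ^ 2) (x z : E) :
    a / 2 * ‖z‖ ^ 2 ≤ φ (x + z) - φ x - inner ℝ (gradient φ x) z ∧
      φ (x + z) - φ x - inner ℝ (gradient φ x) z ≤ b / 2 * ‖z‖ ^ 2 := by
  obtain ⟨g, hg⟩ := ha.exists_subgradient_s17 x
  obtain ⟨k, hk⟩ := hb.neg.exists_subgradient_s17 x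
  have hlow : ∀ z, inner ℝ (g + a • x) z + a / 2 * ‖z‖ ^ 2 ≤ φ (x + z) - φ x := fun z => by
    have := hg z
    rw [norm_add_sq_real] at this
    rw [inner_add_left, inner_smul_left]
    simp only [conj_trivial]
    linarith
  have hupp : ∀ z, φ (x + z) - φ x ≤ inner ℝ (b • x - k) z + b / 2 * ‖z‖ ^ 2 := fun z => by
    have := hk z
    simp only [Pi.neg_apply] at this
    rw [norm_add_sq_real] at this
    rw [inner_sub_left, inner_smul_left]
    simp only [conj_trivial]
    linarith
  have heq : g + a • x = b • x - k := by
    rw [← sub_eq_zero, ← norm_le_zero_iff]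
    have := norm_le_of_forall_inner_le (g := g + a • x - (b • x - k)) (α := |b - a|) (β := 0)
      (D := 0) (abs_nonneg _) le_rfl fun w => by
        rw [inner_sub_left]
        nlinarith [hlow w, hupp w, le_abs_self (b - a), sq_nonneg ‖w‖, abs_nonneg (b - a)]
    simpa using this
  rw [← heq] at hupp
  have hgrad : gradient φ x = g + a • x := by
    apply HasGradientAt.gradient
    rw [hasGradientAt_iff_isLittleO_nhds_zero]
    refine Asymptotics.IsBigO.trans_isLittleO (g := fun z : E => ‖z‖ ^ 2) ?_
      (Asymptotics.isLittleO_norm_pow_id one_lt_two)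
    refine Asymptotics.IsBigO.of_bound (|a| + |b|) (Filter.Eventually.of_forall fun z => ?_)
    rw [Real.norm_eq_abs, norm_pow, norm_norm, abs_le]
    constructor <;> linarith [hlow z, hupp z, mul_nonneg (abs_nonneg a) (sq_nonneg ‖z‖),
      mul_nonneg (abs_nonneg b) (sq_nonneg ‖z‖),
      mul_le_mul_of_nonneg_right (le_abs_self b) (sq_nonneg ‖z‖),
      mul_le_mul_of_nonneg_right (neg_abs_le a) (sq_nonneg ‖z‖)]
  rw [hgrad]
  constructor <;> linarith [hlow z, hupp z]

lemma inner_gradient_sub_bounds {φ : E → ℝ} {a b : ℝ}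
    (ha : ConvexOn ℝ univ fun x => φ x - a / 2 * ‖x‖ ^ 2)
    (hb : ConcaveOn ℝ univ fun x => φ x - b / 2 * ‖x‖ ^ 2) (p q : E) :
    a * ‖p - q‖ ^ 2 ≤ inner ℝ (gradient φ p - gradient φ q) (p - q) ∧
      inner ℝ (gradient φ p - gradient φ q) (p - q) ≤ b * ‖p - q‖ ^ 2 := by
  have h1 := gradient_taylor_bounds ha hb q (p - q)
  have h2 := gradient_taylor_bounds ha hb p (q - p)
  rw [add_sub_cancel] at h1 h2
  rw [norm_sub_rev q p, ← neg_sub p q, inner_neg_right] at h2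
  rw [inner_sub_left]
  constructor <;> linarith [h1.1, h1.2, h2.1, h2.2]

lemma norm_gradient_sub_sub_smul_le {φ : E → ℝ} {a b m κ : ℝ}
    (ha : ConvexOn ℝ univ fun x => φ x - a / 2 * ‖x‖ ^ 2)
    (hb : ConcaveOn ℝ univ fun x => φ x - b / 2 * ‖x‖ ^ 2) (hκ : 0 ≤ κ)
    (hma : m - κ ≤ a) (hmb : b ≤ m + κ) (p q : E) :
    ‖gradient φ p - gradient φ q - m • (p - q)‖ ≤ κ * ‖p - q‖ := by
  have key : ∀ w, inner ℝ (gradient φ p - gradient φ q - m • (p - q)) w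
      ≤ κ / 2 * ‖w‖ ^ 2 + κ / 2 * ‖p - q‖ ^ 2 := fun w => by
    set d := p - q with hd
    have hq : q = p - d := by simp [hd]
    obtain ⟨z, rfl⟩ : ∃ z, w = d + (2 : ℝ) • z := ⟨(1 / 2 : ℝ) • (w - d), by
      rw [smul_smul]; norm_num⟩
    have h1 := (gradient_taylor_bounds ha hb p z).1
    have h2 := (gradient_taylor_bounds ha hb q (d + z)).2
    have h3 := (gradient_taylor_bounds ha hb q (-z)).1
    have h4 := (gradient_taylor_bounds ha hb p (-(d + z))).2
    rw [show q + (d + z) = p + z by rw [hq]; abel] at h2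
    rw [show p + -(d + z) = q + -z by rw [hq]; abel] at h4
    rw [norm_neg] at h3 h4
    simp only [inner_neg_right, inner_add_right, inner_smul_right, inner_sub_left, inner_smul_left,
      norm_add_sq_real, norm_smul, Real.norm_eq_abs, abs_two, mul_pow, conj_trivial,
      real_inner_self_eq_norm_sq] at *
    have hz := sq_nonneg ‖z‖
    have hdz : 0 ≤ ‖d‖ ^ 2 + 2 * inner ℝ d z + ‖z‖ ^ 2 := by
      rw [← norm_add_sq_real]; positivity
    have e1 := mul_le_mul_of_nonneg_right hma hz
    have e2 := mul_le_mul_of_nonneg_right hmb hdz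
    linarith
  have := norm_le_of_forall_inner_le (by positivity) (norm_nonneg _) key
  simpa using this

/-- The off-diagonal block of the Hessian is controlled by the gaps between the bounds on the
diagonal blocks. -/
lemma norm_gradient_slice_sub_le {U : E × F → ℝ} {a a' b b' K r : ℝ}
    (ha : ConvexOn ℝ univ fun p : E × F => U p - a / 2 * ‖p.1‖ ^ 2 - a' / 2 * ‖p.2‖ ^ 2)
    (hb : ConcaveOn ℝ univ fun p : E × F => U p - b / 2 * ‖p.1‖ ^ 2 - b' / 2 * ‖p.2‖ ^ 2)
    (hK : 0 ≤ K) (hr : 0 < r) (hab : (b - a) * r ^ 2 ≤ K) (hab' : b' - a' ≤ K)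
    (q : E) (y y' : F) :
    ‖gradient (fun x => U (x, y)) q - gradient (fun x => U (x, y')) q‖ ≤ K / r * ‖y - y'‖ := by
  have key : ∀ w, inner ℝ (r • (gradient (fun x => U (x, y)) q - gradient (fun x => U (x, y')) q)) w
      ≤ 3 / 4 * K * ‖w‖ ^ 2 + 1 / 4 * K * ‖y - y'‖ ^ 2 := fun w => by
    set u := r • w with hu
    have hun : ‖u‖ ^ 2 = r ^ 2 * ‖w‖ ^ 2 := by
      rw [hu, norm_smul, mul_pow, Real.norm_eq_abs, sq_abs]
    have h1 := (gradient_taylor_bounds (ha.slice y) (hb.slice y) q u).1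
    have h2 := (gradient_taylor_bounds (ha.slice y') (hb.slice y') q u).2
    have h3 := hb.2 (mem_univ (q + u, y)) (mem_univ (q, y'))
      (by norm_num : (0 : ℝ) ≤ 1 / 2) (by norm_num : (0 : ℝ) ≤ 1 / 2) (by norm_num)
    have h4 := ha.2 (mem_univ (q + u, y')) (mem_univ (q, y))
      (by norm_num : (0 : ℝ) ≤ 1 / 2) (by norm_num : (0 : ℝ) ≤ 1 / 2) (by norm_num)
    simp only [Prod.smul_mk, Prod.mk_add_mk, norm_midpoint_sq, smul_eq_mul,
      add_sub_cancel_left] at h3 h4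
    rw [add_comm ((1 / 2 : ℝ) • y') ((1 / 2 : ℝ) • y), norm_sub_rev y' y] at h4
    have hi : inner ℝ (r • (gradient (fun x => U (x, y)) q - gradient (fun x => U (x, y')) q)) w
      = inner ℝ (gradient (fun x => U (x, y)) q) u - inner ℝ (gradient (fun x => U (x, y')) q) u := by
      rw [real_inner_smul_left, ← real_inner_smul_right, inner_sub_left]
    rw [hi]
    have e1 := mul_le_mul_of_nonneg_right hab (sq_nonneg ‖w‖)
    have e2 := mul_le_mul_of_nonneg_right hab' (sq_nonneg ‖y - y'‖)
    rw [mul_assoc, ← hun] at e1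
    linarith
  have := norm_le_of_forall_inner_le (by positivity) (norm_nonneg _) key
  rw [norm_smul, Real.norm_eq_abs, abs_of_pos hr] at this
  rw [div_mul_eq_mul_div, le_div_iff₀ hr]
  linarith

end

/-- Lipschitz estimates for the difference `F̃_{s,t} − π₁` between the
renormalized transport maps and the first-coordinate projection. -/
theorem stmt17 {E F : Type*}
    [NormedAddCommGroup E] [InnerProductSpace ℝ E] [FiniteDimensional ℝ E]
    [NormedAddCommGroup F] [InnerProductSpace ℝ F] [FiniteDimensional ℝ F]
    (c C : ℝ) (hc : 0 < c) (hcC : c ≤ C)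
    (V : ℝ → E × F → ℝ)
    (hconv : ∀ s ∈ Ici (0 : ℝ), ConvexOn ℝ univ
      (fun p : E × F =>
        V s p - c / (2 * (1 + c * s)) * ‖p.1‖ ^ 2 - c / 2 * ‖p.2‖ ^ 2))
    (hconc : ∀ s ∈ Ici (0 : ℝ), ConcaveOn ℝ univ
      (fun p : E × F =>
        V s p - C / (2 * (1 + C * s)) * ‖p.1‖ ^ 2 - C / 2 * ‖p.2‖ ^ 2))
    (Fmap : ℝ → ℝ → E → F → E)
    (hF0 : ∀ t ∈ Ici (0 : ℝ), ∀ (x : E) (y : F), Fmap t t x y = x)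
    (hFode : ∀ t ∈ Ici (0 : ℝ), ∀ (x : E) (y : F), ∀ s ∈ Ici (0 : ℝ),
      HasDerivWithinAt (fun s' => Fmap s' t x y)
        ((1 / 2 : ℝ) • gradient (fun a => V s (a, y)) (Fmap s t x y)) (Ici 0) s)
    (Ft : ℝ → ℝ → E → F → E)
    (hFt : ∀ (s t : ℝ) (x : E) (y : F),
      Ft s t x y =
        Real.exp (-s / 2) •
          Fmap (Real.exp s - 1) (Real.exp t - 1) (Real.exp (t / 2) • x) y) :
    ∀ s ∈ Ici (0 : ℝ), ∀ t ∈ Ici (0 : ℝ),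
      (∀ (y : F) (x x' : E),
        ‖(Ft s t x y - x) - (Ft s t x' y - x')‖ ≤
          1 / 2 * (max C (1 / c) - 1) * Real.sqrt (max C (1 / c)) *
            |Real.exp (-s) - Real.exp (-t)| * ‖x - x'‖) ∧
      (∀ (x x' : E) (y y' : F),
        ‖(Ft s t x y - x) - (Ft s t x' y' - x')‖ ≤
          ((max C (1 / c)) ^ (3 : ℕ) - 1) * Real.sqrt (max C (1 / c)) *
            |Real.exp (-s / 2) - Real.exp (-t / 2)| *
              Real.sqrt (‖x - x'‖ ^ 2 + ‖y - y'‖ ^ 2)) := by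
  set L := max C (1 / c) with hLdef
  have hCL : C ≤ L := le_max_left _ _
  have hcL : L⁻¹ ≤ c := by
    rw [inv_le_comm₀ (lt_max_of_lt_left (hc.trans_le hcC)) hc, inv_eq_one_div]
    exact le_max_right _ _
  have hL0 : 0 < L := (hc.trans_le hcC).trans_le hCL
  have hL : 1 ≤ L := by
    by_contra! h
    have := one_lt_inv_iff₀.2 ⟨hL0, h⟩
    linarith
  have hℓ0 : 0 < L⁻¹ := inv_pos.2 hL0
  have hℓ : L⁻¹ ≤ 1 := inv_le_one_of_one_le₀ hL
  have hLL : L * L⁻¹ = 1 := mul_inv_cancel₀ hL0.ne'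
  have ha : ∀ s ∈ Ici (0 : ℝ), ConvexOn ℝ univ fun p : E × F =>
      V s p - L⁻¹ / (1 + L⁻¹ * s) / 2 * ‖p.1‖ ^ 2 - L⁻¹ / 2 * ‖p.2‖ ^ 2 := fun s hs => by
    have hs := mem_Ici.1 hs
    refine ((hconv s hs).add (convexOn_quadratic
      (α := c / (2 * (1 + c * s)) - L⁻¹ / (1 + L⁻¹ * s) / 2) (β := c / 2 - L⁻¹ / 2)
      ?_ (by linarith))).congr fun p _ => ?_
    · rw [sub_nonneg, div_div, div_le_div_iff₀ (by positivity) (by positivity)]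
      nlinarith
    · simp only [Pi.add_apply]; ring
  have hb : ∀ s ∈ Ici (0 : ℝ), ConcaveOn ℝ univ fun p : E × F =>
      V s p - L / (1 + L * s) / 2 * ‖p.1‖ ^ 2 - L / 2 * ‖p.2‖ ^ 2 := fun s hs => by
    have hs := mem_Ici.1 hs
    have hC0 : 0 < C := hc.trans_le hcC
    refine ((hconc s hs).sub (convexOn_quadratic
      (α := L / (1 + L * s) / 2 - C / (2 * (1 + C * s))) (β := L / 2 - C / 2)
      ?_ (by linarith))).congr fun p _ => ?_
    · rw [sub_nonneg, div_div, div_le_div_iff₀ (by positivity) (by positivity)]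
      nlinarith
    · simp only [Pi.sub_apply]; ring
  set G : ℝ → E → F → E := fun s p y => gradient (fun a => V s (a, y)) p with hG
  have hmono : ∀ s ∈ Ici (0 : ℝ), ∀ y p q,
      L⁻¹ / (1 + L⁻¹ * s) * ‖p - q‖ ^ 2 ≤ inner ℝ (G s p y - G s q y) (p - q) ∧
        inner ℝ (G s p y - G s q y) (p - q) ≤ L / (1 + L * s) * ‖p - q‖ ^ 2 := fun s hs y p q =>
    inner_gradient_sub_bounds ((ha s hs).slice y) ((hb s hs).slice y) p q
  have hlip : ∀ s ∈ Ici (0 : ℝ), ∀ y p q,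
      ‖G s p y - G s q y - (1 + s)⁻¹ • (p - q)‖ ≤ (L - 1) / (1 + s) ^ 2 * ‖p - q‖ :=
    fun s hs y p q => by
      have hs' := mem_Ici.1 hs
      refine norm_gradient_sub_sub_smul_le ((ha s hs).slice y) ((hb s hs).slice y)
        (div_nonneg (by linarith) (by positivity)) ?_ ?_ p q
      · have e : L⁻¹ / (1 + L⁻¹ * s) - ((1 + s)⁻¹ - (L - 1) / (1 + s) ^ 2)
            = (L - 1) ^ 2 / ((L + s) * (1 + s) ^ 2) := by
          field_simp
          ring
        rw [← sub_nonneg, e]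
        positivity
      · have e : (1 + s)⁻¹ + (L - 1) / (1 + s) ^ 2 - L / (1 + L * s)
            = (L - 1) ^ 2 * s / ((1 + L * s) * (1 + s) ^ 2) := by
          field_simp
          ring
        rw [← sub_nonneg, e]
        positivity
  have hoff : ∀ s ∈ Ici (0 : ℝ), ∀ q y y',
      ‖G s q y - G s q y'‖ ≤ (L - L⁻¹) / (1 + s) * ‖y - y'‖ := fun s hs q y y' => by
    have hs' := mem_Ici.1 hs
    refine norm_gradient_slice_sub_le (ha s hs) (hb s hs) (by linarith) (by linarith) ?_ le_rfl
      q y y'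
    have e : L - L⁻¹ - (L / (1 + L * s) - L⁻¹ / (1 + L⁻¹ * s)) * (1 + s) ^ 2
        = (L - L⁻¹) * (s * (L - 1) ^ 2) / ((1 + L * s) * (L + s)) := by
      field_simp
      ring
    rw [← sub_nonneg, e]
    have : 0 ≤ L - L⁻¹ := by linarith
    positivity
  have hode : ∀ t ∈ Ici (0 : ℝ), ∀ x x' y y', ∀ s ∈ Ici (0 : ℝ),
      HasDerivWithinAt (fun r => Fmap r t x y - Fmap r t x' y')
        ((1 / 2 : ℝ) • G s (Fmap s t x y) y - (1 / 2 : ℝ) • G s (Fmap s t x' y') y') (Ici 0) s :=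
    fun t ht x x' y y' s hs => (hFode t ht x y s hs).sub (hFode t ht x' y' s hs)
  have hgrowth : ∀ t ∈ Ici (0 : ℝ), ∀ s ∈ Ici (0 : ℝ), ∀ x x' y y',
      ‖Fmap s t x y - Fmap s t x' y'‖ ≤ √L * √(1 + s) * (‖x - x'‖ / √(1 + t) +
        (L - L⁻¹) * ‖y - y'‖ * |(√(1 + s))⁻¹ - (√(1 + t))⁻¹|) := fun t ht s hs x x' y y' => by
    have hcross : ∀ r ∈ Ici (0 : ℝ), ∀ p q : E,
        |inner ℝ (G r q y - G r q y') (p - q)| ≤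
          (L - L⁻¹) * ‖y - y'‖ / (1 + r) * ‖p - q‖ := fun r hr p q => by
      refine (abs_real_inner_le_norm _ _).trans ?_
      rw [mul_div_right_comm]
      exact mul_le_mul_of_nonneg_right (hoff r hr q y y') (norm_nonneg _)
    have hsplit : ∀ r (p q : E), 2 * inner ℝ ((1 / 2 : ℝ) • G r p y - (1 / 2 : ℝ) • G r q y')
        (p - q) = inner ℝ (G r p y - G r q y) (p - q) + inner ℝ (G r q y - G r q y') (p - q) :=
      fun r p q => by
        rw [← inner_add_left, sub_add_sub_cancel, ← smul_sub, real_inner_smul_left]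
        ring
    have := norm_le_of_critical_growth hL
      (κ := (L - L⁻¹) * ‖y - y'‖) (mul_nonneg (by linarith) (norm_nonneg _))
      (hode t ht x x' y y')
      (fun r hr => by
        rw [hsplit]
        exact add_le_add (hmono r hr y _ _).2 ((le_abs_self _).trans (hcross r hr _ _)))
      (fun r hr => by
        rw [hsplit, sub_eq_add_neg]
        exact add_le_add (hmono r hr y _ _).1 (neg_le_of_abs_le (hcross r hr _ _)))
      hs ht
    simpa only [hF0 t ht] using this
  have hexp : ∀ r : ℝ, √(1 + (Real.exp r - 1)) = Real.exp (r / 2) := fun r => by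
    rw [add_sub_cancel, Real.exp_half]
  have hexp' : ∀ r : ℝ, (Real.exp (r / 2))⁻¹ = Real.exp (-r / 2) := fun r => by
    rw [← Real.exp_neg, neg_div]
  have hexp1 : ∀ r ∈ Ici (0 : ℝ), Real.exp r - 1 ∈ Ici (0 : ℝ) := fun r hr =>
    sub_nonneg.2 (Real.one_le_exp hr)
  intro s hs t ht
  have hfirst : ∀ (y : F) (x x' : E), ‖(Ft s t x y - x) - (Ft s t x' y - x')‖ ≤
      1 / 2 * (L - 1) * √L * |Real.exp (-s) - Real.exp (-t)| * ‖x - x'‖ := fun y x x' => by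
    have h := norm_inv_sqrt_smul_sub_le hL
      (hode (Real.exp t - 1) (hexp1 t ht) (Real.exp (t / 2) • x) (Real.exp (t / 2) • x') y y)
      (D := ‖x - x'‖)
      (fun r hr => by
        rw [← smul_sub, smul_smul, mul_one_div_cancel two_ne_zero, one_smul]
        exact hlip r hr y _ _)
      (fun r hr => by
        have := hgrowth _ (hexp1 t ht) r hr (Real.exp (t / 2) • x) (Real.exp (t / 2) • x') y y
        rwa [sub_self, norm_zero, mul_zero, zero_mul, add_zero, hexp, ← smul_sub, norm_smul,
          Real.norm_of_nonneg (Real.exp_pos _).le, mul_div_cancel_left₀ _ (Real.exp_pos _).ne']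
          at this)
      (hexp1 s hs) (hexp1 t ht)
    rw [hexp, hexp, hexp', hF0 _ (hexp1 t ht), hF0 _ (hexp1 t ht), ← smul_sub, smul_smul,
      inv_mul_cancel₀ (Real.exp_pos _).ne', one_smul, add_sub_cancel, add_sub_cancel,
      ← Real.exp_neg, ← Real.exp_neg] at h
    rw [hFt, hFt, sub_sub_sub_comm, ← smul_sub]
    exact h
  refine ⟨hfirst, fun x x' y y' => ?_⟩
  set Δ := |Real.exp (-s / 2) - Real.exp (-t / 2)| with hΔ
  have hx := hfirst y x x'
  have hy : ‖Ft s t x' y - Ft s t x' y'‖ ≤ √L * ((L - L⁻¹) * ‖y - y'‖ * Δ) := by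
    have h := hgrowth _ (hexp1 t ht) _ (hexp1 s hs) (Real.exp (t / 2) • x')
      (Real.exp (t / 2) • x') y y'
    rw [sub_self, norm_zero, zero_div, zero_add, hexp, hexp, hexp', hexp', ← hΔ] at h
    rw [hFt, hFt, ← smul_sub, norm_smul, Real.norm_of_nonneg (Real.exp_pos _).le, ← hexp',
      inv_mul_le_iff₀ (Real.exp_pos _)]
    linarith
  have hΔ2 : |Real.exp (-s) - Real.exp (-t)| ≤ 2 * Δ := by
    have e : Real.exp (-s) - Real.exp (-t) = (Real.exp (-s / 2) + Real.exp (-t / 2)) *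
        (Real.exp (-s / 2) - Real.exp (-t / 2)) := by
      rw [← add_halves (-s), ← add_halves (-t), Real.exp_add, Real.exp_add, add_halves,
        add_halves]
      ring
    have h1 : Real.exp (-s / 2) ≤ 1 := Real.exp_le_one_iff.2 (by linarith [mem_Ici.1 hs])
    have h2 : Real.exp (-t / 2) ≤ 1 := Real.exp_le_one_iff.2 (by linarith [mem_Ici.1 ht])
    rw [e, abs_mul, abs_of_pos (by positivity)]
    exact mul_le_mul_of_nonneg_right (by linarith) (abs_nonneg _)
  set R := √(‖x - x'‖ ^ 2 + ‖y - y'‖ ^ 2) with hR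
  have hxR : ‖x - x'‖ ≤ R := Real.le_sqrt_of_sq_le (by linarith [sq_nonneg ‖y - y'‖])
  have hyR : ‖y - y'‖ ≤ R := Real.le_sqrt_of_sq_le (by linarith [sq_nonneg ‖x - x'‖])
  have hΔ0 : 0 ≤ Δ := abs_nonneg _
  have hR0 : 0 ≤ R := Real.sqrt_nonneg _
  have hL1 : 0 ≤ L - 1 := sub_nonneg.2 hL
  have hLℓ : 0 ≤ L - L⁻¹ := by linarith
  calc ‖(Ft s t x y - x) - (Ft s t x' y' - x')‖
      = ‖((Ft s t x y - x) - (Ft s t x' y - x')) + (Ft s t x' y - Ft s t x' y')‖ := by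
        congr 1; abel
    _ ≤ 1 / 2 * (L - 1) * √L * |Real.exp (-s) - Real.exp (-t)| * ‖x - x'‖ +
        √L * ((L - L⁻¹) * ‖y - y'‖ * Δ) := norm_add_le_of_le hx hy
    _ ≤ 1 / 2 * (L - 1) * √L * (2 * Δ) * R + √L * ((L - L⁻¹) * R * Δ) := by gcongr
    _ = (L - 1 + (L - L⁻¹)) * (√L * Δ * R) := by ring
    _ ≤ (L ^ 3 - 1) * (√L * Δ * R) := by
        refine mul_le_mul_of_nonneg_right ?_ (by positivity)
        have : 1 - L⁻¹ ≤ L - 1 := by nlinarith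
        nlinarith [mul_nonneg hL1 hL1, mul_nonneg hL1 (mul_nonneg hL1 hL1)]
    _ = _ := by ring
end

section
/- Let E and F be finite-dimensional real inner product spaces, let 0 < c ≤ C, and let V : E × F → ℝ satisfy c ≤ HV ≤ C. Define W : F → ℝ by W(y) = −log ∫_E e^{−V(x,y)} dx. Then the integral is finite and positive for every y ∈ F, and W satisfies c ≤ HW ≤ C; that is, y ↦ W(y) − (c/2)‖y‖² is convex and y ↦ W(y) − (C/2)‖y‖² is concave. Consequently, if (X, Y) is distributed according to the Gibbs measure proportional to e^{−V(x,y)} dx dy, then the marginal distribution of Y is the Gibbs measure of a potential on F satisfying the same two-sided Hessian bounds c and C. -/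
open Set MeasureTheory

/-- One-dimensional Brunn–Minkowski inequality for nonempty compact sets. -/
theorem volume_add_volume_le_of_add_mem {K L S : Set ℝ} (hK : IsCompact K) (hL : IsCompact L)
    (hK' : K.Nonempty) (hL' : L.Nonempty) (h : ∀ x ∈ K, ∀ y ∈ L, x + y ∈ S) :
    volume K + volume L ≤ volume S := by
  have hA : volume ((fun x => x + sInf L) '' K) = volume K := by
    rw [Set.image_add_right, measure_preimage_add_right]
  have hB : volume ((fun y => sSup K + y) '' L) = volume L := by
    rw [Set.image_add_left, measure_preimage_add]
  have hd : AEDisjoint volume ((fun x => x + sInf L) '' K) ((fun y => sSup K + y) '' L) := by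
    refine measure_mono_null (t := {sSup K + sInf L}) ?_ (by simp)
    rintro _ ⟨⟨x, hx, rfl⟩, ⟨y, hy, hxy⟩⟩
    have h1 := le_csSup hK.bddAbove hx
    have h2 := csInf_le hL.bddBelow hy
    simp only [Set.mem_singleton_iff] at *
    linarith
  rw [← hA, ← hB, ← measure_union₀ _ hd]
  · refine measure_mono (Set.union_subset ?_ ?_)
    · rintro _ ⟨x, hx, rfl⟩
      exact h x hx _ (hL.sInf_mem hL')
    · rintro _ ⟨y, hy, rfl⟩
      exact h _ (hK.sSup_mem hK') y hy
  · exact (hL.image (by fun_prop)).measurableSet.nullMeasurableSet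

theorem isCompact_setOf_le_exp_neg {u : ℝ → ℝ} (hu : Continuous u)
    (hu' : Filter.Tendsto u (Filter.cocompact ℝ) Filter.atTop) {t : ℝ} (ht : 0 < t) :
    IsCompact {x | t ≤ Real.exp (-u x)} := by
  obtain ⟨K, hK, hKs⟩ := Filter.mem_cocompact.1 (hu'.eventually_gt_atTop (-Real.log t))
  refine hK.of_isClosed_subset (isClosed_le continuous_const (by fun_prop)) fun x hx => ?_
  by_contra hxK
  have h1 : -Real.log t < u x := hKs hxK
  have h2 := (Real.log_le_iff_le_exp ht).2 hx
  linarith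

open scoped Pointwise in
theorem lintegral_exp_neg_add_le {u v w : ℝ → ℝ} {a b : ℝ} (ha : 0 < a) (hb : 0 < b)
    (hu : Continuous u) (hv : Continuous v) (hw : Continuous w)
    (hu' : Filter.Tendsto u (Filter.cocompact ℝ) Filter.atTop)
    (hv' : Filter.Tendsto v (Filter.cocompact ℝ) Filter.atTop)
    (h : ∀ x y, w (a * x + b * y) ≤ a * u x + b * v y) (hab : a + b = 1)
    {x₀ y₀ : ℝ} (hx₀ : u x₀ = 0) (hy₀ : v y₀ = 0) (hu₀ : ∀ x, 0 ≤ u x) (hv₀ : ∀ y, 0 ≤ v y) :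
    ENNReal.ofReal a * (∫⁻ x, ENNReal.ofReal (Real.exp (-u x))) +
      ENNReal.ofReal b * ∫⁻ x, ENNReal.ofReal (Real.exp (-v x)) ≤
      ∫⁻ x, ENNReal.ofReal (Real.exp (-w x)) := by
  have layer : ∀ f : ℝ → ℝ, Continuous f → ∫⁻ x, ENNReal.ofReal (Real.exp (-f x)) =
      ∫⁻ t in Set.Ioi (0 : ℝ), volume {x | t ≤ Real.exp (-f x)} := fun f hf =>
    lintegral_eq_lintegral_meas_le volume (Filter.Eventually.of_forall fun x => (Real.exp_pos _).le)
      (by fun_prop)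
  have anti : ∀ f : ℝ → ℝ, Measurable fun t : ℝ => volume {x | t ≤ Real.exp (-f x)} := fun f =>
    Antitone.measurable fun s t hst => measure_mono fun x hx => hst.trans hx
  rw [layer u hu, layer v hv, layer w hw, ← lintegral_const_mul _ (anti u),
    ← lintegral_const_mul _ (anti v), ← lintegral_add_left ((anti u).const_mul _)]
  refine setLIntegral_mono (anti w) fun t ht => ?_
  have ht0 : 0 < t := ht
  rcases le_or_gt t 1 with h1 | h1
  · have scale : ∀ (r : ℝ) (s : Set ℝ), 0 < r → ENNReal.ofReal r * volume s = volume (r • s) := by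
      intro r s hr
      rw [Measure.addHaar_smul]
      simp [abs_of_pos hr]
    have hKu := isCompact_setOf_le_exp_neg hu hu' ht0
    have hKv := isCompact_setOf_le_exp_neg hv hv' ht0
    rw [scale a _ ha, scale b _ hb]
    refine volume_add_volume_le_of_add_mem (hKu.smul a) (hKv.smul b)
      (Set.Nonempty.smul_set ⟨x₀, by simpa [hx₀] using h1⟩)
      (Set.Nonempty.smul_set ⟨y₀, by simpa [hy₀] using h1⟩) ?_
    rintro _ ⟨x, hx, rfl⟩ _ ⟨y, hy, rfl⟩
    simp only [Set.mem_ofPred_eq, ← Real.log_le_iff_le_exp ht0, smul_eq_mul] at hx hy ⊢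
    have h2 : a * Real.log t + b * Real.log t = Real.log t := by rw [← add_mul, hab, one_mul]
    nlinarith [h x y]
  · have hem : ∀ f : ℝ → ℝ, (∀ x, 0 ≤ f x) → {x | t ≤ Real.exp (-f x)} = ∅ := by
      intro f hf
      ext x
      have : Real.exp (-f x) ≤ 1 := Real.exp_le_one_iff.2 (by linarith [hf x])
      simp only [Set.mem_ofPred_eq, Set.mem_empty_iff_false, iff_false, not_le]
      linarith
    simp [hem u hu₀, hem v hv₀]

theorem add_integral_exp_neg_le {u v w : ℝ → ℝ} {a b : ℝ} (ha : 0 < a) (hb : 0 < b)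
    (hab : a + b = 1) (hu : Continuous u) (hv : Continuous v) (hw : Continuous w)
    (hu' : Filter.Tendsto u (Filter.cocompact ℝ) Filter.atTop)
    (hv' : Filter.Tendsto v (Filter.cocompact ℝ) Filter.atTop)
    (iu : Integrable fun x => Real.exp (-u x)) (iv : Integrable fun x => Real.exp (-v x))
    (iw : Integrable fun x => Real.exp (-w x))
    (h : ∀ x y, w (a * x + b * y) ≤ a * u x + b * v y)
    {x₀ y₀ : ℝ} (hx₀ : u x₀ = 0) (hy₀ : v y₀ = 0) (hu₀ : ∀ x, 0 ≤ u x) (hv₀ : ∀ y, 0 ≤ v y) :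
    a * (∫ x, Real.exp (-u x)) + b * ∫ x, Real.exp (-v x) ≤ ∫ x, Real.exp (-w x) := by
  have key := lintegral_exp_neg_add_le ha hb hu hv hw hu' hv' h hab hx₀ hy₀ hu₀ hv₀
  have pos : ∀ f : ℝ → ℝ, 0 ≤ᵐ[volume] fun x => Real.exp (-f x) := fun f =>
    Filter.Eventually.of_forall fun x => (Real.exp_pos _).le
  have nn : ∀ f : ℝ → ℝ, 0 ≤ ∫ x, Real.exp (-f x) := fun f => integral_nonneg_of_ae (pos f)
  rw [← ofReal_integral_eq_lintegral_ofReal iu (pos u),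
    ← ofReal_integral_eq_lintegral_ofReal iv (pos v),
    ← ofReal_integral_eq_lintegral_ofReal iw (pos w), ← ENNReal.ofReal_mul ha.le,
    ← ENNReal.ofReal_mul hb.le, ← ENNReal.ofReal_add (mul_nonneg ha.le (nn u))
      (mul_nonneg hb.le (nn v)), ENNReal.ofReal_le_ofReal_iff (nn w)] at key
  exact key

/-- One-dimensional Prékopa–Leindler inequality, in terms of coercive potentials. -/
theorem neg_log_integral_exp_neg_le {u v w : ℝ → ℝ} {a b : ℝ} (ha : 0 < a) (hb : 0 < b)
    (hab : a + b = 1) (hu : Continuous u) (hv : Continuous v) (hw : Continuous w)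
    (hu' : Filter.Tendsto u (Filter.cocompact ℝ) Filter.atTop)
    (hv' : Filter.Tendsto v (Filter.cocompact ℝ) Filter.atTop)
    (iu : Integrable fun x => Real.exp (-u x)) (iv : Integrable fun x => Real.exp (-v x))
    (iw : Integrable fun x => Real.exp (-w x))
    (h : ∀ x y, w (a * x + b * y) ≤ a * u x + b * v y) :
    -Real.log (∫ x, Real.exp (-w x)) ≤
      a * -Real.log (∫ x, Real.exp (-u x)) + b * -Real.log (∫ x, Real.exp (-v x)) := by
  obtain ⟨x₀, hx₀⟩ := hu.exists_forall_le hu'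
  obtain ⟨y₀, hy₀⟩ := hv.exists_forall_le hv'
  have shift : ∀ (f : ℝ → ℝ) (r : ℝ),
      (fun x => Real.exp (-(f x - r))) = fun x => Real.exp r * Real.exp (-f x) := by
    intro f r
    ext x
    rw [← Real.exp_add]
    ring_nf
  have key := add_integral_exp_neg_le (u := fun x => u x - u x₀) (v := fun x => v x - v y₀)
    (w := fun x => w x - (a * u x₀ + b * v y₀)) ha hb hab (by fun_prop) (by fun_prop)
    (by fun_prop) (by simpa [sub_eq_add_neg] using Filter.tendsto_atTop_add_const_right _ _ hu')
    (by simpa [sub_eq_add_neg] using Filter.tendsto_atTop_add_const_right _ _ hv')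
    (by rw [shift]; exact iu.const_mul _) (by rw [shift]; exact iv.const_mul _)
    (by rw [shift]; exact iw.const_mul _)
    (fun x y => by linarith [h x y]) (sub_self (u x₀)) (sub_self (v y₀))
    (fun x => sub_nonneg.2 (hx₀ x)) (fun x => sub_nonneg.2 (hy₀ x))
  rw [shift, shift, shift, integral_const_mul, integral_const_mul, integral_const_mul] at key
  have pu := integral_exp_pos iu
  have pv := integral_exp_pos iv
  have pw := integral_exp_pos iw
  have hlog := strictConcaveOn_log_Ioi.concaveOn.2
    (Set.mem_Ioi.2 (mul_pos (Real.exp_pos (u x₀)) pu))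
    (Set.mem_Ioi.2 (mul_pos (Real.exp_pos (v y₀)) pv)) ha.le hb.le hab
  simp only [smul_eq_mul] at hlog
  have hmono := Real.log_le_log (by positivity) key
  rw [Real.log_mul (Real.exp_ne_zero _) pw.ne', Real.log_exp] at hmono
  rw [Real.log_mul (Real.exp_ne_zero _) pu.ne', Real.log_mul (Real.exp_ne_zero _) pv.ne',
    Real.log_exp, Real.log_exp] at hlog
  linarith

theorem ConvexOn.exists_neg_mul_one_add_norm_le {E : Type*} [NormedAddCommGroup E]
    [NormedSpace ℝ E] [FiniteDimensional ℝ E] {f : E → ℝ} (hf : ConvexOn ℝ Set.univ f) :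
    ∃ B, 0 ≤ B ∧ ∀ x, -(B * (1 + ‖x‖)) ≤ f x := by
  have hcont : Continuous f := hf.locallyLipschitz.continuous
  obtain ⟨m, hm⟩ := (isCompact_closedBall (0 : E) 1).bddBelow_image hcont.continuousOn
  have hm' : ∀ x : E, ‖x‖ ≤ 1 → m ≤ f x := fun x hx => hm ⟨x, by simpa using hx, rfl⟩
  refine ⟨|m| + |f 0|, by positivity, fun x => ?_⟩
  have e1 := neg_abs_le m
  have e2 := le_abs_self (f 0)
  have e3 := abs_nonneg (f 0)
  have e4 := abs_nonneg m
  have e5 := norm_nonneg x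
  rcases le_or_gt ‖x‖ 1 with h | h
  · nlinarith [hm' x h, mul_nonneg (add_nonneg e4 e3) e5]
  · have hr : 0 < ‖x‖ := by linarith
    have hx : m ≤ f (‖x‖⁻¹ • x) := hm' _ (by
      rw [norm_smul, norm_inv, norm_norm, inv_mul_cancel₀ hr.ne'])
    have hc := hf.2 (Set.mem_univ x) (Set.mem_univ 0) (inv_nonneg.2 hr.le)
      (sub_nonneg.2 (inv_le_one_of_one_le₀ h.le)) (by ring)
    simp only [smul_zero, add_zero, smul_eq_mul] at hc
    have h3 := mul_le_mul_of_nonneg_left (hx.trans hc) hr.le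
    have h4 : ‖x‖ * (‖x‖⁻¹ * f x + (1 - ‖x‖⁻¹) * f 0) = f x + (‖x‖ - 1) * f 0 := by
      field_simp
    rw [h4] at h3
    have h5 : (‖x‖ - 1) * f 0 ≤ (‖x‖ - 1) * |f 0| := mul_le_mul_of_nonneg_left e2 (by linarith)
    have h6 : ‖x‖ * -|m| ≤ ‖x‖ * m := mul_le_mul_of_nonneg_left e1 hr.le
    nlinarith

theorem exists_sub_le_of_convexOn_sub {E : Type*} [NormedAddCommGroup E]
    [NormedSpace ℝ E] [FiniteDimensional ℝ E] {c : ℝ} (hc : 0 < c) {V N : E → ℝ}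
    (hN : ∀ x, ‖x‖ ^ 2 ≤ N x) (hf : ConvexOn ℝ Set.univ fun x => V x - c / 2 * N x) :
    ∃ K, ∀ x, c / 4 * N x - K ≤ V x := by
  obtain ⟨B, hB, h⟩ := hf.exists_neg_mul_one_add_norm_le
  refine ⟨B + B ^ 2 / c, fun x => ?_⟩
  have h1 := h x
  have h2 : B * ‖x‖ ≤ c / 4 * ‖x‖ ^ 2 + B ^ 2 / c := by
    have : c / 4 * ‖x‖ ^ 2 + B ^ 2 / c - B * ‖x‖ = (c * ‖x‖ / 2 - B) ^ 2 / c := by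
      field_simp
      ring
    have : 0 ≤ (c * ‖x‖ / 2 - B) ^ 2 / c := by positivity
    linarith
  nlinarith [hN x]

theorem integrable_exp_neg_of_convexOn_sub {E : Type*} [NormedAddCommGroup E]
    [NormedSpace ℝ E] [FiniteDimensional ℝ E] [MeasurableSpace E] [BorelSpace E] {μ : Measure E}
    {c : ℝ} (hc : 0 < c) {V N : E → ℝ} (hN : ∀ x, ‖x‖ ^ 2 ≤ N x) (hNc : Continuous N)
    (hi : Integrable (fun x => Real.exp (-(c / 4) * N x)) μ)
    (hf : ConvexOn ℝ Set.univ fun x => V x - c / 2 * N x) :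
    Continuous V ∧ Integrable (fun x => Real.exp (-V x)) μ := by
  have hV : Continuous V := by
    have := hf.locallyLipschitz.continuous.add
      (continuous_const.mul hNc : Continuous fun x => c / 2 * N x)
    exact this.congr fun x => sub_add_cancel _ _
  obtain ⟨K, hK⟩ := exists_sub_le_of_convexOn_sub hc hN hf
  refine ⟨hV, (hi.const_mul (Real.exp K)).mono' (by fun_prop)
    (Filter.Eventually.of_forall fun x => ?_)⟩
  rw [Real.norm_eq_abs, Real.abs_exp, ← Real.exp_add]
  exact Real.exp_le_exp.2 (by linarith [hK x])

theorem integrable_exp_neg_mul_norm_sq {E : Type*} [NormedAddCommGroup E] [InnerProductSpace ℝ E]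
    [FiniteDimensional ℝ E] [MeasurableSpace E] [BorelSpace E] {r : ℝ} (hr : 0 < r) :
    Integrable fun x : E => Real.exp (-r * ‖x‖ ^ 2) := by
  have := (GaussianFourier.integrable_cexp_neg_mul_sq_norm_add (V := E) (b := (r : ℂ))
    (by simpa using hr) 0 0).re
  refine this.congr (Filter.Eventually.of_forall fun x => ?_)
  have : (-(r : ℂ) * (‖x‖ : ℂ) ^ 2 + 0 * ((inner ℝ (0 : E) x : ℝ) : ℂ)) =
      ((-r * ‖x‖ ^ 2 : ℝ) : ℂ) := by
    push_cast
    ring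
  simp only [this]
  exact Complex.exp_ofReal_re _

theorem ConvexOn.slice_left {X G : Type*} [AddCommGroup X] [Module ℝ X] [AddCommGroup G]
    [Module ℝ G] {U : X × G → ℝ} (h : ConvexOn ℝ Set.univ U) (y : G) :
    ConvexOn ℝ Set.univ fun x => U (x, y) := by
  refine ⟨convex_univ, fun x _ x' _ a b ha hb hab => ?_⟩
  have := h.2 (Set.mem_univ (x, y)) (Set.mem_univ (x', y)) ha hb hab
  simpa [Convex.combo_self hab] using this

theorem ConvexOn.slice_right {X G : Type*} [AddCommGroup X] [Module ℝ X] [AddCommGroup G]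
    [Module ℝ G] {U : X × G → ℝ} (h : ConvexOn ℝ Set.univ U) (x : X) :
    ConvexOn ℝ Set.univ fun y => U (x, y) := by
  refine ⟨convex_univ, fun y _ y' _ a b ha hb hab => ?_⟩
  have := h.2 (Set.mem_univ (x, y)) (Set.mem_univ (x, y')) ha hb hab
  simpa [Convex.combo_self hab] using this

theorem integrable_exp_neg_real {c : ℝ} (hc : 0 < c) {V : ℝ → ℝ}
    (h : ConvexOn ℝ Set.univ fun t => V t - c / 2 * t ^ 2) :
    Continuous V ∧ Integrable fun t => Real.exp (-V t) := by
  refine integrable_exp_neg_of_convexOn_sub hc (N := fun t => t ^ 2) (by simp) (by fun_prop) ?_ h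
  exact integrable_exp_neg_mul_sq (by positivity)

theorem tendsto_cocompact_of_convexOn_sub {c : ℝ} (hc : 0 < c) {V : ℝ → ℝ}
    (h : ConvexOn ℝ Set.univ fun t => V t - c / 2 * t ^ 2) :
    Filter.Tendsto V (Filter.cocompact ℝ) Filter.atTop := by
  obtain ⟨K, hK⟩ := exists_sub_le_of_convexOn_sub hc (N := fun t => t ^ 2) (by simp) h
  refine Filter.tendsto_atTop_mono hK ?_
  have h1 : Filter.Tendsto (fun t : ℝ => ‖t‖ ^ 2) (Filter.cocompact ℝ) Filter.atTop :=
    (Filter.tendsto_pow_atTop two_ne_zero).comp (tendsto_norm_cocompact_atTop (E := ℝ))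
  have h2 := Filter.tendsto_atTop_add_const_right _ (-K)
    (h1.const_mul_atTop (by positivity : 0 < c / 4))
  simpa [sub_eq_add_neg] using h2

/-- Prékopa's theorem for one integrated variable. -/
theorem convexOn_neg_log_integral_real {G : Type*} [AddCommGroup G] [Module ℝ G] {c : ℝ}
    (hc : 0 < c) {V : ℝ × G → ℝ}
    (h : ConvexOn ℝ Set.univ fun p => V p - c / 2 * p.1 ^ 2) :
    ConvexOn ℝ Set.univ fun y => -Real.log (∫ t, Real.exp (-V (t, y))) := by
  refine convexOn_iff_forall_pos.2 ⟨convex_univ, fun y _ y' _ a b ha hb hab => ?_⟩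
  have hs := fun y => h.slice_left y
  refine neg_log_integral_exp_neg_le ha hb hab
    (integrable_exp_neg_real hc (hs y)).1 (integrable_exp_neg_real hc (hs y')).1
    (integrable_exp_neg_real hc (hs _)).1
    (tendsto_cocompact_of_convexOn_sub hc (hs y)) (tendsto_cocompact_of_convexOn_sub hc (hs y'))
    (integrable_exp_neg_real hc (hs y)).2 (integrable_exp_neg_real hc (hs y')).2
    (integrable_exp_neg_real hc (hs _)).2 fun s t => ?_
  have h1 := h.2 (Set.mem_univ (s, y)) (Set.mem_univ (t, y')) ha.le hb.le hab
  simp only [Prod.smul_mk, Prod.mk_add_mk, smul_eq_mul] at h1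
  have h2 : a * s ^ 2 + b * t ^ 2 - (a * s + b * t) ^ 2 = a * b * (s - t) ^ 2 := by
    rw [eq_sub_of_add_eq hab]
    ring
  have h3 : 0 ≤ a * b * (s - t) ^ 2 := by positivity
  nlinarith

theorem integrable_exp_neg_pi {n : ℕ} {c : ℝ} (hc : 0 < c) {V : (Fin n → ℝ) → ℝ}
    (h : ConvexOn ℝ Set.univ fun x => V x - c / 2 * ∑ i, x i ^ 2) :
    Continuous V ∧ Integrable fun x => Real.exp (-V x) := by
  refine integrable_exp_neg_of_convexOn_sub hc (N := fun x => ∑ i, x i ^ 2) (fun x => ?_)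
    (by fun_prop) ?_ h
  · have h0 : 0 ≤ ∑ i, x i ^ 2 := Finset.sum_nonneg fun i _ => sq_nonneg _
    rw [← Real.le_sqrt (norm_nonneg _) h0, pi_norm_le_iff_of_nonneg (Real.sqrt_nonneg _)]
    intro i
    rw [Real.le_sqrt (norm_nonneg _) h0, Real.norm_eq_abs, sq_abs]
    exact Finset.single_le_sum (f := fun i => x i ^ 2) (fun i _ => sq_nonneg _) (Finset.mem_univ i)
  · simp only [Finset.mul_sum, Real.exp_sum]
    exact Integrable.fintype_prod (f := fun _ t => Real.exp (-(c / 4) * t ^ 2)) fun _ =>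
      integrable_exp_neg_mul_sq (by positivity)

/-- Prékopa's theorem for finitely many integrated coordinates. -/
theorem convexOn_neg_log_integral_pi {c : ℝ} (hc : 0 < c) (n : ℕ) :
    ∀ {G : Type*} [AddCommGroup G] [Module ℝ G] {V : (Fin n → ℝ) × G → ℝ},
    (ConvexOn ℝ Set.univ fun p => V p - c / 2 * ∑ i, p.1 i ^ 2) →
    ConvexOn ℝ Set.univ fun y => -Real.log (∫ x, Real.exp (-V (x, y))) := by
  induction n with
  | zero =>
    intro G _ _ V h
    have h1 := h.slice_right 0
    simpa [volume_pi, Measure.pi_of_empty (x := (0 : Fin 0 → ℝ))] using h1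
  | succ n ih =>
    intro G _ _ V h
    have hcons : ∀ (a b s t : ℝ) (x x' : Fin n → ℝ),
        (Fin.cons (a * s + b * t) (a • x + b • x') : Fin (n + 1) → ℝ) =
          a • (Fin.cons s x : Fin (n + 1) → ℝ) + b • (Fin.cons t x' : Fin (n + 1) → ℝ) := by
      intro a b s t x x'
      ext i
      refine Fin.cases ?_ (fun j => ?_) i <;> simp
    have h1 : ConvexOn ℝ Set.univ fun p : ℝ × ((Fin n → ℝ) × G) =>
        (V (Fin.cons p.1 p.2.1, p.2.2) - c / 2 * ∑ i, p.2.1 i ^ 2) - c / 2 * p.1 ^ 2 := by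
      refine ⟨convex_univ, ?_⟩
      rintro ⟨s, x, y⟩ - ⟨t, x', y'⟩ - a b ha hb hab
      have := h.2 (Set.mem_univ ((Fin.cons s x : Fin (n + 1) → ℝ), y))
        (Set.mem_univ ((Fin.cons t x' : Fin (n + 1) → ℝ), y')) ha hb hab
      simp only [Prod.smul_mk, Prod.mk_add_mk, ← hcons, Fin.sum_univ_succ, Fin.cons_zero,
        Fin.cons_succ, smul_eq_mul] at this ⊢
      linarith
    have h2 := convexOn_neg_log_integral_real hc h1
    have hint : ∀ y, Integrable fun x => Real.exp (-V (x, y)) := fun y =>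
      (integrable_exp_neg_pi hc (h.slice_left y)).2
    have hslice : ∀ x y, Integrable fun t : ℝ =>
        Real.exp (-V ((Fin.cons t x : Fin (n + 1) → ℝ), y)) := by
      intro x y
      have := (integrable_exp_neg_real hc (h1.slice_left (x, y))).2
      refine (this.mul_const (Real.exp (-(c / 2 * ∑ i, x i ^ 2)))).congr
        (Filter.Eventually.of_forall fun t => ?_)
      simp only [← Real.exp_add]
      ring_nf
    have h3 := ih (G := G) (V := fun p =>
      -Real.log (∫ t, Real.exp (-V ((Fin.cons t p.1 : Fin (n + 1) → ℝ), p.2)))) (by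
        refine h2.congr fun p _ => ?_
        have : (fun t : ℝ => Real.exp (-(V ((Fin.cons t p.1 : Fin (n + 1) → ℝ), p.2) -
            c / 2 * ∑ i, p.1 i ^ 2))) = fun t => Real.exp (c / 2 * ∑ i, p.1 i ^ 2) *
              Real.exp (-V ((Fin.cons t p.1 : Fin (n + 1) → ℝ), p.2)) := by
          ext t
          rw [← Real.exp_add]
          ring_nf
        simp only [this, integral_const_mul]
        rw [Real.log_mul (Real.exp_ne_zero _) (integral_exp_pos (hslice p.1 p.2)).ne',
          Real.log_exp]
        ring)
    refine h3.congr fun y _ => ?_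
    have mp := (volume_preserving_piFinSuccAbove (fun _ : Fin (n + 1) => ℝ) 0).symm
    have e1 := mp.integral_comp (MeasurableEquiv.measurableEmbedding _) fun x => Real.exp (-V (x, y))
    have i1 := (mp.integrable_comp_emb (MeasurableEquiv.measurableEmbedding _)).2 (hint y)
    have e2 := integral_prod_symm _ i1
    simp only [Function.comp_def, MeasurableEquiv.piFinSuccAbove_symm_apply] at e1 e2
    simp only [neg_neg]
    rw [← e1, Measure.volume_eq_prod, e2]
    congr 3
    ext x
    rw [Real.exp_log (integral_exp_pos (hslice x y))]
    simp [Fin.insertNthEquiv]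

/-- Prékopa's theorem over a finite-dimensional inner product space. -/
theorem convexOn_neg_log_integral {E G : Type*} [NormedAddCommGroup E] [InnerProductSpace ℝ E]
    [FiniteDimensional ℝ E] [MeasurableSpace E] [BorelSpace E] [AddCommGroup G] [Module ℝ G]
    {c : ℝ} (hc : 0 < c) {V : E × G → ℝ}
    (h : ConvexOn ℝ Set.univ fun p => V p - c / 2 * ‖p.1‖ ^ 2) :
    ConvexOn ℝ Set.univ fun y => -Real.log (∫ x, Real.exp (-V (x, y))) := by
  let e := (stdOrthonormalBasis ℝ E).repr
  have h1 := convexOn_neg_log_integral_pi hc (Module.finrank ℝ E) (G := G)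
    (V := fun p => V (e.symm (WithLp.toLp 2 p.1), p.2)) (by
      have hn : ∀ x : Fin (Module.finrank ℝ E) → ℝ,
          ∑ i, x i ^ 2 = ‖e.symm (WithLp.toLp 2 x)‖ ^ 2 := by
        intro x
        rw [LinearIsometryEquiv.norm_map, EuclideanSpace.real_norm_sq_eq]
      refine ⟨convex_univ, ?_⟩
      rintro ⟨x, y⟩ - ⟨x', y'⟩ - a b ha hb hab
      have := h.2 (Set.mem_univ (e.symm (WithLp.toLp 2 x), y))
        (Set.mem_univ (e.symm (WithLp.toLp 2 x'), y')) ha hb hab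
      simp only [hn]
      simpa only [Prod.smul_mk, Prod.mk_add_mk, WithLp.toLp_add, WithLp.toLp_smul, map_add,
        map_smul] using this)
  have mp := e.symm.measurePreserving.comp
    (EuclideanSpace.volume_preserving_symm_measurableEquiv_toLp (Fin (Module.finrank ℝ E))).symm
  refine h1.congr fun y _ => ?_
  have := mp.integral_comp (e.symm.toMeasurableEquiv.measurableEmbedding.comp
    (MeasurableEquiv.measurableEmbedding _)) fun x => Real.exp (-V (x, y))
  rw [← this]
  rfl

/-- The logarithm of the integral of an exponential is convex in the exponent. -/
theorem log_integral_exp_le {α : Type*} [MeasurableSpace α] {μ : Measure α} [NeZero μ]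
    {f g h : α → ℝ} {a b : ℝ} (ha : 0 ≤ a) (hb : 0 ≤ b) (hab : a + b = 1)
    (hf : Integrable (fun x => Real.exp (f x)) μ) (hg : Integrable (fun x => Real.exp (g x)) μ)
    (hh : Integrable (fun x => Real.exp (h x)) μ) (hle : ∀ x, h x ≤ a * f x + b * g x) :
    Real.log (∫ x, Real.exp (h x) ∂μ) ≤
      a * Real.log (∫ x, Real.exp (f x) ∂μ) + b * Real.log (∫ x, Real.exp (g x) ∂μ) := by
  have pf := integral_exp_pos hf
  have pg := integral_exp_pos hg
  set P := Real.log (∫ x, Real.exp (f x) ∂μ) with hP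
  set Q := Real.log (∫ x, Real.exp (g x) ∂μ) with hQ
  have eP : Real.exp (-P) * ∫ x, Real.exp (f x) ∂μ = 1 := by
    rw [Real.exp_neg, hP, Real.exp_log pf, inv_mul_cancel₀ pf.ne']
  have eQ : Real.exp (-Q) * ∫ x, Real.exp (g x) ∂μ = 1 := by
    rw [Real.exp_neg, hQ, Real.exp_log pg, inv_mul_cancel₀ pg.ne']
  rw [Real.log_le_iff_le_exp (integral_exp_pos hh)]
  have key : ∀ x, Real.exp (h x) ≤ Real.exp (a * P + b * Q) *
      (a * (Real.exp (-P) * Real.exp (f x)) + b * (Real.exp (-Q) * Real.exp (g x))) := by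
    intro x
    have h1 := convexOn_exp.2 (Set.mem_univ (-P + f x)) (Set.mem_univ (-Q + g x)) ha hb hab
    simp only [smul_eq_mul, Real.exp_add (-P), Real.exp_add (-Q)] at h1
    refine le_trans ?_ (mul_le_mul_of_nonneg_left h1 (Real.exp_pos _).le)
    rw [← Real.exp_add]
    exact Real.exp_le_exp.2 (by linarith [hle x])
  have i1 := (hf.const_mul (Real.exp (-P))).const_mul a
  have i2 := (hg.const_mul (Real.exp (-Q))).const_mul b
  have := integral_mono hh ((i1.add i2).const_mul (Real.exp (a * P + b * Q))) key
  refine this.trans_eq ?_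
  simp only [Pi.add_apply]
  rw [integral_const_mul, integral_add i1 i2]
  simp only [integral_const_mul]
  rw [eP, eQ]
  simp [hab]

/-- marginals of Gibbs measures with uniformly convex and semi-concave
potentials. If `c ≤ HV ≤ C` on `E × F`, then `W(y) = −log ∫_E e^{−V(x,y)} dx` is
well-defined and satisfies `c ≤ HW ≤ C`, and the second marginal of the Gibbs measure of
`V` is the Gibbs measure of a potential on `F` with the same Hessian bounds. -/
theorem stmt18 {E F : Type*}
    [NormedAddCommGroup E] [InnerProductSpace ℝ E] [FiniteDimensional ℝ E]
    [MeasurableSpace E] [BorelSpace E]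
    [NormedAddCommGroup F] [InnerProductSpace ℝ F] [FiniteDimensional ℝ F]
    [MeasurableSpace F] [BorelSpace F]
    (c C : ℝ) (hc : 0 < c) (hcC : c ≤ C) (V : E × F → ℝ)
    (hconv : ConvexOn ℝ univ
      (fun p : E × F => V p - c / 2 * (‖p.1‖ ^ 2 + ‖p.2‖ ^ 2)))
    (hconc : ConcaveOn ℝ univ
      (fun p : E × F => V p - C / 2 * (‖p.1‖ ^ 2 + ‖p.2‖ ^ 2))) :
    (∀ y : F,
      Integrable (fun x => Real.exp (-V (x, y))) (volume : Measure E) ∧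
      0 < ∫ x, Real.exp (-V (x, y))) ∧
    ConvexOn ℝ univ
      (fun y : F => -Real.log (∫ x, Real.exp (-V (x, y))) - c / 2 * ‖y‖ ^ 2) ∧
    ConcaveOn ℝ univ
      (fun y : F => -Real.log (∫ x, Real.exp (-V (x, y))) - C / 2 * ‖y‖ ^ 2) ∧
    ∀ μ : Measure (E × F),
      μ = (volume : Measure (E × F)).withDensity
          (fun p => ENNReal.ofReal ((∫ q, Real.exp (-V q))⁻¹ * Real.exp (-V p))) →
      ∃ W : F → ℝ,
        ConvexOn ℝ univ (fun y : F => W y - c / 2 * ‖y‖ ^ 2) ∧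
        ConcaveOn ℝ univ (fun y : F => W y - C / 2 * ‖y‖ ^ 2) ∧
        Measure.map Prod.snd μ =
          (volume : Measure F).withDensity
            (fun y => ENNReal.ofReal ((∫ y', Real.exp (-W y'))⁻¹ * Real.exp (-W y))) := by
  have hU : ConvexOn ℝ univ fun p : E × F => (V p - c / 2 * ‖p.2‖ ^ 2) - c / 2 * ‖p.1‖ ^ 2 :=
    hconv.congr fun p _ => by ring
  have hexp : ∀ (r s : ℝ), Real.exp (-(s - r)) = Real.exp r * Real.exp (-s) := fun r s => by
    rw [← Real.exp_add]
    ring_nf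
  have hint : ∀ y : F, Integrable fun x : E => Real.exp (-V (x, y)) := by
    intro y
    have h1 : ConvexOn ℝ univ fun x : E => V (x, y) - c / 2 * ‖x‖ ^ 2 :=
      ((hconv.slice_left y).add_const (c / 2 * ‖y‖ ^ 2)).congr fun x _ => by
        simp only [Pi.add_apply]
        ring
    exact (integrable_exp_neg_of_convexOn_sub hc (N := fun x => ‖x‖ ^ 2) (fun x => le_rfl)
      (by fun_prop) (integrable_exp_neg_mul_norm_sq (by positivity)) h1).2
  have hpos : ∀ y : F, 0 < ∫ x : E, Real.exp (-V (x, y)) := fun y => integral_exp_pos (hint y)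
  have hWconv : ConvexOn ℝ univ
      fun y : F => -Real.log (∫ x, Real.exp (-V (x, y))) - c / 2 * ‖y‖ ^ 2 := by
    refine (convexOn_neg_log_integral hc hU).congr fun y _ => ?_
    simp only [hexp, integral_const_mul]
    rw [Real.log_mul (Real.exp_ne_zero _) (hpos y).ne', Real.log_exp]
    ring
  have hWconc : ConcaveOn ℝ univ
      fun y : F => -Real.log (∫ x, Real.exp (-V (x, y))) - C / 2 * ‖y‖ ^ 2 := by
    have hW : ∀ y : F, Real.log (∫ x : E, Real.exp (-(V (x, y) - C / 2 * ‖y‖ ^ 2))) =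
        C / 2 * ‖y‖ ^ 2 + Real.log (∫ x : E, Real.exp (-V (x, y))) := by
      intro y
      simp only [hexp, integral_const_mul]
      rw [Real.log_mul (Real.exp_ne_zero _) (hpos y).ne', Real.log_exp]
    have hi : ∀ y : F, Integrable fun x : E => Real.exp (-(V (x, y) - C / 2 * ‖y‖ ^ 2)) := by
      intro y
      simp only [hexp]
      exact (hint y).const_mul _
    refine ⟨convex_univ, fun y _ y' _ a b ha hb hab => ?_⟩
    have key := log_integral_exp_le ha hb hab (hi y) (hi y') (hi (a • y + b • y')) fun x => by
      have h1 := hconc.2 (mem_univ (x, y)) (mem_univ (x, y')) ha hb hab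
      simp only [Prod.smul_mk, Prod.mk_add_mk, smul_eq_mul, Convex.combo_self hab] at h1
      linear_combination h1 + C / 2 * ‖x‖ ^ 2 * hab
    rw [hW, hW, hW] at key
    simp only [smul_eq_mul]
    linarith
  refine ⟨fun y => ⟨hint y, hpos y⟩, hWconv, hWconc, ?_⟩
  rintro μ rfl
  refine ⟨fun y => -Real.log (∫ x, Real.exp (-V (x, y))), hWconv, hWconc, ?_⟩
  obtain ⟨hVc, hVi⟩ := integrable_exp_neg_of_convexOn_sub (μ := (volume : Measure (E × F))) hc
    (N := fun p : E × F => ‖p.1‖ ^ 2 + ‖p.2‖ ^ 2) (fun p => by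
      rcases max_choice ‖p.1‖ ‖p.2‖ with h | h <;> rw [Prod.norm_def, h] <;> simp)
    (by fun_prop) (by
      simp only [mul_add, Real.exp_add]
      exact (integrable_exp_neg_mul_norm_sq (by positivity)).mul_prod
        (integrable_exp_neg_mul_norm_sq (by positivity))) hconv
  have hZ : ∫ q, Real.exp (-V q) = ∫ y : F, ∫ x : E, Real.exp (-V (x, y)) :=
    integral_prod_symm _ hVi
  simp only [neg_neg, Real.exp_log (hpos _), ← hZ]
  have hZ0 : 0 ≤ (∫ q, Real.exp (-V q))⁻¹ :=
    inv_nonneg.2 (integral_nonneg fun _ => (Real.exp_pos _).le)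
  generalize (∫ q, Real.exp (-V q))⁻¹ = Z at hZ0 ⊢
  ext s hs
  have hm : Measurable fun p : E × F => ENNReal.ofReal (Z * Real.exp (-V p)) := by fun_prop
  rw [Measure.map_apply measurable_snd hs, withDensity_apply _ (measurable_snd hs),
    withDensity_apply _ hs, ← univ_prod, Measure.volume_eq_prod, ← Measure.prod_restrict,
    Measure.restrict_univ, lintegral_prod_symm _ hm.aemeasurable]
  refine lintegral_congr fun y => ?_
  rw [← integral_const_mul]
  exact (ofReal_integral_eq_lintegral_ofReal ((hint y).const_mul _)
    (Filter.Eventually.of_forall fun x => mul_nonneg hZ0 (Real.exp_pos _).le)).symm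
end
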